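/- Let (X,d) be a compact metric space and f: X → X a topologically mixing homeomorphism with the exponential shadowing property, and let A: X → GL(m,ℝ) be a Hölder continuous matrix function. If μ ↦ χ_max(A,μ) is lower semi-continuous on the space of f-invariant measures with the weak* topology, then either (1) all ergodic f-invariant measures have the same maximal Lyapunov exponent with respect to A; or (2) h^B_top(f, MLI(A,f)) = h_top(f, MLI(A,f)) = h^P_top(f, MLI(A,f)) = h_top(f). -/

import Mathlib

open Filter MeasureTheory Set Topology Manifold
open scoped ENNReal NNReal

section EntropyDefs

variable {X : Type*} [MetricSpace X]

/-- The open dynamical (Bowen) ball `B_n(x,r) = {y | d_n(x,y) < r}`. -/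
def dynBall (f : X → X) (x : X) (n : ℕ) (r : ℝ) : Set X :=
  {y | ∀ i < n, dist (f^[i] x) (f^[i] y) < r}

/-- The closed dynamical (Bowen) ball `{y | d_n(x,y) ≤ r}`. -/
def dynCBall (f : X → X) (x : X) (n : ℕ) (r : ℝ) : Set X :=
  {y | ∀ i < n, dist (f^[i] x) (f^[i] y) ≤ r}

/-- `S` is an `(n,ε)`-separated subset of `E`. -/
def IsDynSep (f : X → X) (E : Set X) (n : ℕ) (ε : ℝ) (S : Set X) : Prop :=
  S ⊆ E ∧ ∀ x ∈ S, ∀ y ∈ S, x ≠ y → ∃ i < n, ε < dist (f^[i] x) (f^[i] y)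

/-- The maximal cardinality `s_n(E,ε)` of an `(n,ε)`-separated subset of `E`. -/
noncomputable def sepCount (f : X → X) (E : Set X) (n : ℕ) (ε : ℝ) : ℕ :=
  sSup {k | ∃ S : Finset X, IsDynSep f E n ε ↑S ∧ S.card = k}

/-- Bowen's separated-set topological entropy of a compact set:
`lim_{ε→0} limsup_n (1/n) log s_n(E,ε)`. -/
noncomputable def compactEnt (f : X → X) (E : Set X) : EReal :=
  ⨆ (ε : ℝ) (_ : 0 < ε),
    Filter.limsup (fun n : ℕ => ((Real.log (sepCount f E n ε) / n : ℝ) : EReal)) Filter.atTop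

/-- Topological entropy of an arbitrary subset `Y`: the supremum over compact `E ⊆ Y`. -/
noncomputable def topEnt (f : X → X) (Y : Set X) : EReal :=
  ⨆ (E : Set X) (_ : IsCompact E) (_ : E ⊆ Y), compactEnt f E

/-- The sum `Σ e^{-t·u}` over a family of Bowen balls recorded as center/order pairs. -/
noncomputable def bowenSum (t : ℝ) (s : Set (X × ℕ)) : ℝ≥0∞ :=
  ∑' p : s, ENNReal.ofReal (Real.exp (-t * ((p : X × ℕ).2 : ℝ)))

/-- `C(E;t,n,σ,f)`: infimum of `Σ e^{-t·u}` over countable covers of `E` by Bowen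
balls `B_u(x,σ)` with `u ≥ n`. -/
noncomputable def bowenCn (f : X → X) (E : Set X) (t : ℝ) (σ : ℝ) (n : ℕ) : ℝ≥0∞ :=
  ⨅ (s : Set (X × ℕ)) (_ : s.Countable) (_ : ∀ p ∈ s, n ≤ p.2)
    (_ : E ⊆ ⋃ p ∈ s, dynBall f p.1 p.2 σ), bowenSum t s

/-- `C(E;t,σ,f) = lim_{n→∞} C(E;t,n,σ,f)` (the limit of the nondecreasing sequence). -/
noncomputable def bowenC (f : X → X) (E : Set X) (t : ℝ) (σ : ℝ) : ℝ≥0∞ :=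
  ⨆ n : ℕ, bowenCn f E t σ n

/-- Bowen–Hausdorff entropy at scale `σ`: `inf {t | C(E;t,σ,f) = 0}`. -/
noncomputable def bowenEntAt (f : X → X) (E : Set X) (σ : ℝ) : EReal :=
  sInf {t : EReal | ∃ t' : ℝ, t = (t' : EReal) ∧ bowenC f E t' σ = 0}

/-- Bowen–Hausdorff entropy `h^B_top(f,E) = lim_{σ→0} h^B_top(E;σ,f)`. -/
noncomputable def bowenEnt (f : X → X) (E : Set X) : EReal :=
  ⨆ (σ : ℝ) (_ : 0 < σ), bowenEntAt f E σ

/-- Feng–Huang packing pre-measure `P^s_{N,ε}(E)`: supremum of `Σ e^{-s·n_i}` over countable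
pairwise disjoint families of closed Bowen balls of orders `n_i ≥ N` centered in `E`. -/
noncomputable def packPre (f : X → X) (s : ℝ) (N : ℕ) (ε : ℝ) (E : Set X) : ℝ≥0∞ :=
  ⨆ (D : Set (X × ℕ)) (_ : D.Countable) (_ : ∀ p ∈ D, p.1 ∈ E ∧ N ≤ p.2)
    (_ : D.Pairwise fun p q => Disjoint (dynCBall f p.1 p.2 ε) (dynCBall f q.1 q.2 ε)),
    ∑' p : D, ENNReal.ofReal (Real.exp (-s * ((p : X × ℕ).2 : ℝ)))

/-- `P^s_ε(E) = lim_{N→∞} P^s_{N,ε}(E)` (the limit of the nonincreasing sequence). -/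
noncomputable def packPreLim (f : X → X) (s ε : ℝ) (E : Set X) : ℝ≥0∞ :=
  ⨅ N : ℕ, packPre f s N ε E

/-- Feng–Huang packing measure `𝒫^s_ε(E) = inf {Σ_i P^s_ε(E_i) | E ⊆ ⋃ E_i}`. -/
noncomputable def packMeas (f : X → X) (s ε : ℝ) (E : Set X) : ℝ≥0∞ :=
  ⨅ (C : ℕ → Set X) (_ : E ⊆ ⋃ i, C i), ∑' i, packPreLim f s ε (C i)

/-- Packing topological entropy at scale `ε`: the critical exponent of `s ↦ 𝒫^s_ε(E)`. -/
noncomputable def packEntAt (f : X → X) (E : Set X) (ε : ℝ) : EReal :=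
  sInf {t : EReal | ∃ t' : ℝ, t = (t' : EReal) ∧ packMeas f t' ε E = 0}

/-- Packing topological entropy `h^P_top(f,E) = lim_{ε→0} h^P_top(f,E,ε)`. -/
noncomputable def packEnt (f : X → X) (E : Set X) : EReal :=
  ⨆ (ε : ℝ) (_ : 0 < ε), packEntAt f E ε

/-- The restriction of `f` to `Λ` is topologically mixing. -/
def TopMixingOn (f : X → X) (Λ : Set X) : Prop :=
  ∀ U V : Set X, IsOpen U → IsOpen V → (U ∩ Λ).Nonempty → (V ∩ Λ).Nonempty →
    ∃ N : ℕ, ∀ n ≥ N, (f^[n] '' (U ∩ Λ) ∩ (V ∩ Λ)).Nonempty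

end EntropyDefs

section MetricEntropy

variable {X : Type*} [MeasurableSpace X]

/-- Entropy `H_μ(⋁_{i=0}^{n-1} f^{-i} ξ)` of the `n`-th dynamical refinement of the finite
measurable partition `ξ = {P⁻¹(c)}_{c}`. -/
noncomputable def partHn (f : X → X) (μ : MeasureTheory.Measure X) {k : ℕ}
    (P : X → Fin k) (n : ℕ) : ℝ :=
  ∑ c : Fin n → Fin k,
    Real.negMulLog (μ {x | ∀ i : Fin n, P (f^[(i : ℕ)] x) = c i}).toReal

/-- Kolmogorov–Sinai metric entropy `h_μ(f)`: the supremum over finite measurable partitions of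
`lim_n (1/n) H_μ(⋁_{i<n} f^{-i} ξ) = inf_{n ≥ 1} (1/n) H_μ(⋁_{i<n} f^{-i} ξ)`. -/
noncomputable def ksEnt (f : X → X) (μ : MeasureTheory.Measure X) : EReal :=
  ⨆ (k : ℕ) (P : X → Fin k) (_ : Measurable P),
    (((⨅ n : ℕ, partHn f μ P (n + 1) / ((n : ℝ) + 1)) : ℝ) : EReal)

end MetricEntropy

section CocycleDefs

/-- Euclidean space `ℝ^m`. -/
abbrev Em (m : ℕ) := EuclideanSpace ℝ (Fin m)

variable {X : Type*} {m : ℕ}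

/-- The cocycle generated by the `GL(m,ℝ)`-valued function `A` over `f`:
`A(x,n) = A(f^{n-1}x) ⋯ A(f x) A(x)`. -/
noncomputable def cocycle (f : X → X) (A : X → (Em m ≃L[ℝ] Em m)) (x : X) :
    ℕ → (Em m →L[ℝ] Em m)
  | 0 => ContinuousLinearMap.id ℝ (Em m)
  | n + 1 => ((A (f^[n] x) : Em m →L[ℝ] Em m)).comp (cocycle f A x n)

/-- `A` is an `α`-Hölder continuous matrix function for some exponent `α > 0`
(in the operator norm). -/
def HolderMat [MetricSpace X] (A : X → (Em m ≃L[ℝ] Em m)) : Prop :=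
  ∃ α C : ℝ, 0 < α ∧ 0 ≤ C ∧ ∀ x y : X,
    ‖((A x : Em m →L[ℝ] Em m)) - ((A y : Em m →L[ℝ] Em m))‖ ≤ C * dist x y ^ α

/-- The set `MLI(A,f)` of Max-Lyapunov-irregular points: points where
`lim_n (1/n) log ‖A(x,n)‖` does not exist. -/
def MLIrr (f : X → X) (A : X → (Em m ≃L[ℝ] Em m)) : Set X :=
  {x | ¬ ∃ c : ℝ,
    Filter.Tendsto (fun n : ℕ => Real.log ‖cocycle f A x n‖ / n) Filter.atTop (nhds c)}

/-- The maximal Lyapunov exponent of an invariant measure: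
`χ_max(A,μ) = lim_n (1/n) ∫ log ‖A(x,n)‖ dμ = inf_{n ≥ 1} (1/n) ∫ log ‖A(x,n)‖ dμ`. -/
noncomputable def mle [MeasurableSpace X] (f : X → X) (A : X → (Em m ≃L[ℝ] Em m))
    (μ : MeasureTheory.Measure X) : ℝ :=
  ⨅ n : ℕ, (∫ x, Real.log ‖cocycle f A x (n + 1)‖ ∂μ) / ((n : ℝ) + 1)

/-- `μ` is a Lyapunov-minimizing (ergodic) measure for the cocycle `A`:
`χ_max(A,μ) = inf {χ_max(A,ν) : ν an f-invariant Borel probability measure}`. -/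
def IsLyapMin [MeasurableSpace X] (f : X → X) (A : X → (Em m ≃L[ℝ] Em m))
    (μ : MeasureTheory.Measure X) : Prop :=
  mle f A μ = sInf {r : ℝ | ∃ ν : MeasureTheory.Measure X,
    MeasureTheory.IsProbabilityMeasure ν ∧ MeasureTheory.MeasurePreserving f ν ν ∧
    r = mle f A ν}

end CocycleDefs

section ShadowingDefs

variable {X : Type*} [MetricSpace X]

/-- The cumulative times `c_i` associated with a sequence of block lengths `(n_i)_{i∈ℤ}`. -/
def csum (nseq : ℤ → ℕ) (i : ℤ) : ℤ :=
  if 0 ≤ i then ∑ j ∈ Finset.range i.toNat, (nseq j : ℤ)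
  else -∑ j ∈ Finset.range (-i).toNat, (nseq (i + j) : ℤ)

/-- `{x_i, n_i}_{i∈ℤ}` is a `δ`-pseudo-orbit for `f`: `d(f^{n_i}(x_i), x_{i+1}) < δ`. -/
def IsPseudoOrbit (f : X → X) (δ : ℝ) (x : ℤ → X) (nseq : ℤ → ℕ) : Prop :=
  (∀ i, 1 ≤ nseq i) ∧ ∀ i : ℤ, dist (f^[nseq i] (x i)) (x (i + 1)) < δ

/-- `p` is a `(τ,λ)`-shadowing point for the pseudo-orbit `{x_i, n_i}`:
`d(f^{c_i+j}(p), f^j(x_i)) < τ e^{-λ min{j, n_i - j}}` for `0 ≤ j ≤ n_i - 1`, `i ∈ ℤ`. -/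
def IsExpShadowed (f : X ≃ X) (τ lam : ℝ) (x : ℤ → X) (nseq : ℤ → ℕ) (p : X) : Prop :=
  ∀ i : ℤ, ∀ j < nseq i,
    dist ((f ^ (csum nseq i + (j : ℤ)) : X ≃ X) p) ((⇑f)^[j] (x i))
      < τ * Real.exp (-lam * ((min j (nseq i - j) : ℕ) : ℝ))

/-- The `λ`-exponential shadowing property. -/
def ExpShadowingWith (f : X ≃ X) (lam : ℝ) : Prop :=
  ∀ τ > (0 : ℝ), ∃ δ > (0 : ℝ), ∀ (x : ℤ → X) (nseq : ℤ → ℕ),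
    IsPseudoOrbit (⇑f) δ x nseq → ∃ p : X, IsExpShadowed f τ lam x nseq p

/-- The exponential shadowing property: `λ`-exponential shadowing for some `λ > 0`. -/
def ExpShadowing (f : X ≃ X) : Prop := ∃ lam > (0 : ℝ), ExpShadowingWith f lam

end ShadowingDefs

section EntropyComparison

variable {X : Type*} [MetricSpace X]

lemma isOpen_dynBall {f : X → X} (hf : Continuous f) (x : X) (n : ℕ) (r : ℝ) :
    IsOpen (dynBall f x n r) := by
  have h : dynBall f x n r = ⋂ i ∈ Set.Iio n, {y | dist (f^[i] x) (f^[i] y) < r} := by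
    ext y; simp [dynBall]
  rw [h]
  exact (Set.finite_Iio n).isOpen_biInter fun i _ =>
    isOpen_lt (continuous_const.dist (hf.iterate i)) continuous_const

lemma exists_card_le_of_isDynSep [CompactSpace X] {f : X → X} (hf : Continuous f) (E : Set X)
    (n : ℕ) {ε : ℝ} (hε : 0 < ε) :
    ∃ T : ℕ, ∀ S : Finset X, IsDynSep f E n ε ↑S → S.card ≤ T := by
  obtain ⟨t, ht⟩ := isCompact_univ.elim_finite_subcover (fun x : X => dynBall f x n (ε / 2))
    (fun x => isOpen_dynBall hf x n _)
    (fun x _ => mem_iUnion.2 ⟨x, fun i _ => by simpa using half_pos hε⟩)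
  refine ⟨t.card, fun S hS => ?_⟩
  have hc : ∀ x : X, ∃ y ∈ t, x ∈ dynBall f y n (ε / 2) := fun x => by
    simpa using ht (mem_univ x)
  choose c hct hc using hc
  refine Finset.card_le_card_of_injOn c (fun x _ => hct x) fun x hx y hy hxy => ?_
  by_contra hne
  obtain ⟨i, hi, hlt⟩ := hS.2 x hx y hy hne
  have h1 := hc x i hi
  have h2 := hc y i hi
  rw [← hxy] at h2
  have := dist_triangle_left (f^[i] x) (f^[i] y) (f^[i] (c x))
  linarith

variable {f : X → X}

lemma card_le_sepCount [CompactSpace X] (hf : Continuous f) {E : Set X} {n : ℕ} {ε : ℝ} (hε : 0 < ε)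
    {S : Finset X} (hS : IsDynSep f E n ε ↑S) : S.card ≤ sepCount f E n ε := by
  obtain ⟨T, hT⟩ := exists_card_le_of_isDynSep hf E n hε
  exact le_csSup ⟨T, by rintro k ⟨S, hS, rfl⟩; exact hT S hS⟩ ⟨S, hS, rfl⟩

lemma exists_card_eq_sepCount [CompactSpace X] (hf : Continuous f) (E : Set X) (n : ℕ) {ε : ℝ}
    (hε : 0 < ε) : ∃ S : Finset X, IsDynSep f E n ε ↑S ∧ S.card = sepCount f E n ε := by
  obtain ⟨T, hT⟩ := exists_card_le_of_isDynSep hf E n hε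
  exact Nat.sSup_mem (s := {k | ∃ S : Finset X, IsDynSep f E n ε ↑S ∧ S.card = k})
    ⟨0, ∅, ⟨by simp, by simp⟩, rfl⟩ ⟨T, by rintro k ⟨S, hS, rfl⟩; exact hT S hS⟩

lemma sepCount_pos [CompactSpace X] (hf : Continuous f) {E : Set X} (hE : E.Nonempty) (n : ℕ)
    {ε : ℝ} (hε : 0 < ε) : 1 ≤ sepCount f E n ε := by
  obtain ⟨x, hx⟩ := hE
  refine card_le_sepCount hf hε (S := {x}) ⟨by simpa using hx, ?_⟩
  simp only [Finset.coe_singleton, mem_singleton_iff]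
  rintro a rfl b rfl h
  exact absurd rfl h

lemma sepCount_mono [CompactSpace X] (hf : Continuous f) {E E' : Set X} (h : E ⊆ E') (n : ℕ) {ε : ℝ}
    (hε : 0 < ε) : sepCount f E n ε ≤ sepCount f E' n ε := by
  obtain ⟨S, hS, hc⟩ := exists_card_eq_sepCount hf E n hε
  rw [← hc]
  exact card_le_sepCount hf hε ⟨hS.1.trans h, hS.2⟩

lemma compactEnt_mono [CompactSpace X] (hf : Continuous f) {E E' : Set X} (h : E ⊆ E') :
    compactEnt f E ≤ compactEnt f E' := by
  rcases E.eq_empty_or_nonempty with rfl | hE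
  · refine iSup₂_mono fun ε hε => limsup_le_limsup (Eventually.of_forall fun n => ?_)
    have h0 : sepCount f ∅ n ε = 0 := by
      obtain ⟨S, hS, hc⟩ := exists_card_eq_sepCount hf ∅ n hε
      have : S = ∅ := by simpa using subset_empty_iff.1 hS.1
      rw [← hc, this, Finset.card_empty]
    simp only [h0, EReal.coe_le_coe_iff]
    simp only [CharP.cast_eq_zero, Real.log_zero, zero_div]
    exact div_nonneg (Real.log_natCast_nonneg _) (Nat.cast_nonneg _)
  refine iSup₂_mono fun ε hε => limsup_le_limsup (Eventually.of_forall fun n => ?_)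
  simp only [EReal.coe_le_coe_iff]
  have h1 := sepCount_pos hf hE n hε
  gcongr
  exact sepCount_mono hf h n hε

lemma topEnt_univ_eq [CompactSpace X] (hf : Continuous f) : topEnt f univ = compactEnt f univ :=
  le_antisymm (iSup_le fun _ => iSup_le fun _ => iSup_le fun h => compactEnt_mono hf h)
    (le_iSup_of_le univ <| le_iSup_of_le isCompact_univ <| le_iSup_of_le subset_rfl le_rfl)

lemma eventually_sepCount_le {E : Set X} {ε t : ℝ} (hε : 0 < ε) (ht : compactEnt f E < t) :
    ∃ t' < t, ∀ᶠ n : ℕ in atTop, (sepCount f E n ε : ℝ) ≤ Real.exp (t' * n) := by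
  have h1 : Filter.limsup (fun n : ℕ => ((Real.log (sepCount f E n ε) / n : ℝ) : EReal))
      Filter.atTop < t := lt_of_le_of_lt (le_iSup₂_of_le ε hε le_rfl) ht
  obtain ⟨t', h2, h3⟩ := EReal.lt_iff_exists_real_btwn.1 h1
  refine ⟨t', by exact_mod_cast h3, ?_⟩
  filter_upwards [eventually_lt_of_limsup_lt h2, eventually_gt_atTop 0] with n hn hn0
  have hn0' : (0 : ℝ) < n := by exact_mod_cast hn0
  have h4 : Real.log (sepCount f E n ε) / n < t' := by exact_mod_cast hn
  rw [div_lt_iff₀ hn0'] at h4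
  rcases Nat.eq_zero_or_pos (sepCount f E n ε) with h0 | h0
  · rw [h0]; simpa using (Real.exp_pos _).le
  · rw [← Real.log_le_iff_le_exp (by exact_mod_cast h0)]; exact h4.le

lemma sepCount_mul_exp_le {E : Set X} {ε t : ℝ} (hε : 0 < ε) (ht : compactEnt f E < t) :
    ∃ r : ℝ, 0 < r ∧ r < 1 ∧ ∀ᶠ n : ℕ in atTop,
      (sepCount f E n ε : ℝ≥0∞) * ENNReal.ofReal (Real.exp (-t * n)) ≤ ENNReal.ofReal r ^ n := by
  obtain ⟨t', h1, h2⟩ := eventually_sepCount_le hε ht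
  refine ⟨Real.exp (t' - t), Real.exp_pos _, by simpa using h1, ?_⟩
  filter_upwards [h2] with n hn
  rw [← ENNReal.ofReal_pow (Real.exp_pos _).le, ← Real.exp_nat_mul,
    ← ENNReal.ofReal_natCast, ← ENNReal.ofReal_mul (Nat.cast_nonneg _)]
  refine ENNReal.ofReal_le_ofReal ?_
  calc (sepCount f E n ε : ℝ) * Real.exp (-t * n) ≤ Real.exp (t' * n) * Real.exp (-t * n) := by
        gcongr
    _ = _ := by rw [← Real.exp_add]; ring_nf

/-- A family of orbit segments of common length `n` covering `E` bounds `bowenCn`. -/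
lemma bowenCn_le_of_cover {E : Set X} {t σ : ℝ} {n : ℕ} (S : Finset X)
    (hS : E ⊆ ⋃ x ∈ S, dynBall f x n σ) :
    bowenCn f E t σ n ≤ S.card * ENNReal.ofReal (Real.exp (-t * n)) := by
  refine (iInf₂_le_of_le ((S ×ˢ {n} : Finset (X × ℕ)) : Set (X × ℕ))
    (Finset.countable_toSet _) <| iInf₂_le_of_le ?_ ?_ le_rfl).trans ?_
  · rintro ⟨x, k⟩ h
    simp only [Finset.coe_product, Finset.coe_singleton, mem_prod, mem_singleton_iff] at h
    exact h.2.ge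
  · intro x hx
    obtain ⟨y, hy, hxy⟩ := mem_iUnion₂.1 (hS hx)
    exact mem_iUnion₂.2 ⟨(y, n), by simpa using hy, hxy⟩
  · have key : bowenSum t ((S ×ˢ {n} : Finset (X × ℕ)) : Set (X × ℕ))
        = ∑ p ∈ S ×ˢ {n}, ENNReal.ofReal (Real.exp (-t * ((p : X × ℕ).2 : ℝ))) :=
      Finset.tsum_subtype' (S ×ˢ {n} : Finset (X × ℕ))
        (fun p : X × ℕ => ENNReal.ofReal (Real.exp (-t * (p.2 : ℝ))))
    rw [key, Finset.sum_product]
    simp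

lemma bowenCn_le_sepCount [CompactSpace X] (hf : Continuous f) {E : Set X} {t σ ε : ℝ}
    (hε : 0 < ε) (hεσ : ε < σ) (n : ℕ) : bowenCn f E t σ n ≤ sepCount f E n ε * ENNReal.ofReal (Real.exp (-t * n)) := by
  classical
  obtain ⟨S, hS, hc⟩ := exists_card_eq_sepCount hf E n hε
  rw [← hc]
  refine bowenCn_le_of_cover S fun x hx => ?_
  by_contra hcon
  simp only [mem_iUnion, exists_prop, not_exists, not_and, dynBall, mem_ofPred_eq, not_forall,
    not_lt] at hcon
  have hx' : x ∉ S := fun h => by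
    obtain ⟨i, _, h2⟩ := hcon x h
    simp only [dist_self] at h2
    linarith
  have h3 : IsDynSep f E n ε ↑(insert x S) := by
    refine ⟨by simpa [insert_subset_iff] using ⟨hx, hS.1⟩, ?_⟩
    simp only [Finset.coe_insert]
    rintro a (rfl | ha) b (rfl | hb) hab
    · exact absurd rfl hab
    · obtain ⟨i, hi, h2⟩ := hcon b hb
      exact ⟨i, hi, by rw [dist_comm]; linarith⟩
    · obtain ⟨i, hi, h2⟩ := hcon a ha
      exact ⟨i, hi, by linarith⟩
    · exact hS.2 a ha b hb hab
  have h4 := card_le_sepCount hf hε h3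
  rw [Finset.card_insert_of_notMem hx', ← hc] at h4
  omega

lemma bowenEnt_le_compactEnt [CompactSpace X] (hf : Continuous f) (E : Set X) :
    bowenEnt f E ≤ compactEnt f E := by
  refine iSup₂_le fun σ hσ => EReal.le_of_forall_lt_iff_le.1 fun t ht => ?_
  refine sInf_le ⟨t, rfl, ?_⟩
  obtain ⟨r, hr0, hr1, hr⟩ := sepCount_mul_exp_le (half_pos hσ) ht
  have hlim : Tendsto (fun n : ℕ => ENNReal.ofReal r ^ n) atTop (𝓝 0) :=
    ENNReal.tendsto_pow_atTop_nhds_zero_of_lt_one (by simpa using hr1)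
  have hmono : ∀ n m : ℕ, n ≤ m → bowenCn f E t σ n ≤ bowenCn f E t σ m := fun n m hnm =>
    iInf_mono fun s => iInf_mono fun _ => iInf_mono' fun h =>
      ⟨fun p hp => hnm.trans (h p hp), le_rfl⟩
  refine ENNReal.iSup_eq_zero.2 fun n => le_antisymm (ge_of_tendsto hlim ?_) bot_le
  filter_upwards [hr, eventually_ge_atTop n] with k hk hnk
  exact (hmono n k hnk).trans ((bowenCn_le_sepCount hf (half_pos hσ) (half_lt_self hσ) k).trans hk)

lemma bowenEntAt_mono {E E' : Set X} (h : E ⊆ E') (σ : ℝ) :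
    bowenEntAt f E σ ≤ bowenEntAt f E' σ := by
  refine sInf_le_sInf ?_
  rintro _ ⟨t, rfl, ht⟩
  refine ⟨t, rfl, le_antisymm (ht ▸ iSup_mono fun n => ?_) bot_le⟩
  exact iInf_mono fun s => iInf_mono fun _ => iInf_mono fun _ =>
    iInf_mono' fun h' => ⟨h.trans h', le_rfl⟩

lemma bowenEnt_mono {E E' : Set X} (h : E ⊆ E') : bowenEnt f E ≤ bowenEnt f E' :=
  iSup₂_mono fun σ _ => bowenEntAt_mono h σ

lemma packMeas_mono {E E' : Set X} (h : E ⊆ E') (s ε : ℝ) :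
    packMeas f s ε E ≤ packMeas f s ε E' :=
  iInf_mono fun _ => iInf_mono' fun h' => ⟨h.trans h', le_rfl⟩

lemma packMeas_le_packPreLim (s ε : ℝ) (E : Set X) :
    packMeas f s ε E ≤ packPreLim f s ε E := by
  have hempty : packPreLim f s ε ∅ = 0 := by
    refine le_antisymm (iInf_le_of_le 0 ?_) bot_le
    refine iSup₂_le fun D _ => iSup₂_le fun hD _ => ?_
    have : D = ∅ := eq_empty_of_forall_notMem fun p hp => (hD p hp).1
    subst this
    simp
  refine iInf₂_le_of_le (fun i => if i = 0 then E else ∅) (fun x hx => ?_) ?_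
  · exact mem_iUnion.2 ⟨0, by simpa using hx⟩
  · rw [tsum_eq_single 0 (fun i hi => by simp [hi, hempty])]
    simp

lemma packPre_le_tsum [CompactSpace X] (hf : Continuous f) {s ε : ℝ} (hε : 0 < ε) (N : ℕ)
    (E : Set X) :
    packPre f s N ε E ≤
      ∑' n : ℕ, (sepCount f E (n + N) ε : ℝ≥0∞) *
        ENNReal.ofReal (Real.exp (-s * ((n + N : ℕ) : ℝ))) := by
  classical
  refine iSup₂_le fun D _ => iSup₂_le fun hD hdisj => ?_
  have hfib : ∀ n : ℕ, ∀ F : Finset X, (∀ x ∈ F, (x, n) ∈ D) → F.card ≤ sepCount f E n ε := by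
    intro n F hF
    refine card_le_sepCount hf hε ⟨fun x hx => (hD _ (hF x hx)).1, fun x hx y hy hxy => ?_⟩
    by_contra hcon
    simp only [not_exists, not_and, not_lt] at hcon
    have h1 := hdisj (hF x hx) (hF y hy) (by simpa using hxy)
    exact Set.disjoint_left.1 h1 (show y ∈ dynCBall f x n ε from hcon)
      (fun i _ => by simpa using hε.le)
  rw [ENNReal.tsum_eq_iSup_sum]
  refine iSup_le fun F => ?_
  set G : Finset (X × ℕ) := F.map (Function.Embedding.subtype _) with hG
  have hGD : ∀ p ∈ G, p ∈ D := by
    intro p hp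
    simp only [hG, Finset.mem_map, Function.Embedding.coe_subtype] at hp
    obtain ⟨a, _, rfl⟩ := hp
    exact a.2
  have h1 : ∑ p ∈ F, ENNReal.ofReal (Real.exp (-s * ((p : X × ℕ).2 : ℝ)))
      = ∑ p ∈ G, ENNReal.ofReal (Real.exp (-s * (p.2 : ℝ))) := by
    rw [hG, Finset.sum_map]; rfl
  rw [h1, ← Finset.sum_fiberwise_of_maps_to (t := (G.image fun p => p.2 - N))
    (g := fun p => p.2 - N) (fun p hp => Finset.mem_image_of_mem _ hp)]
  refine le_trans (Finset.sum_le_sum fun n _ => ?_) (ENNReal.sum_le_tsum (G.image fun p => p.2 - N))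
  have h2 : ∀ p ∈ G.filter fun p => p.2 - N = n, p.2 = n + N := by
    intro p hp
    rw [Finset.mem_filter] at hp
    have := (hD p (hGD p hp.1)).2
    omega
  rw [Finset.sum_congr rfl fun p hp => by rw [h2 p hp], Finset.sum_const, nsmul_eq_mul]
  gcongr
  rw [← Finset.card_image_of_injOn (f := Prod.fst)]
  · refine hfib (n + N) _ fun x hx => ?_
    obtain ⟨p, hp, rfl⟩ := Finset.mem_image.1 hx
    have h3 := h2 p hp
    have h4 := hGD p (Finset.mem_filter.1 hp).1
    rwa [← h3]
  · intro p hp q hq hpq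
    exact Prod.ext hpq ((h2 p hp).trans (h2 q hq).symm)

lemma packEnt_le_compactEnt_univ [CompactSpace X] (hf : Continuous f) (E : Set X) :
    packEnt f E ≤ compactEnt f univ := by
  refine iSup₂_le fun ε hε => EReal.le_of_forall_lt_iff_le.1 fun t ht => ?_
  refine sInf_le ⟨t, rfl, le_antisymm ?_ bot_le⟩
  refine (packMeas_mono (subset_univ E) t ε).trans ((packMeas_le_packPreLim t ε univ).trans ?_)
  obtain ⟨r, hr0, hr1, hr⟩ := sepCount_mul_exp_le hε ht
  obtain ⟨N₀, hN₀⟩ := eventually_atTop.1 hr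
  have hr1' : ENNReal.ofReal r < 1 := by simpa using hr1
  have hsum : ∑' n : ℕ, ENNReal.ofReal r ^ n ≠ ∞ := by
    rw [ENNReal.tsum_geometric]
    exact ENNReal.inv_ne_top.2 (tsub_pos_of_lt hr1').ne'
  have hlim := ENNReal.tendsto_sum_nat_add (fun n : ℕ => ENNReal.ofReal r ^ n) hsum
  refine ge_of_tendsto hlim ?_
  filter_upwards [eventually_ge_atTop N₀] with N hN
  refine (iInf_le _ N).trans ((packPre_le_tsum hf hε N univ).trans ?_)
  exact ENNReal.tsum_le_tsum fun n => hN₀ (n + N) (by omega)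

lemma bowenCn_le_packPre [CompactSpace X] (hf : Continuous f) {s ε : ℝ} (hε : 0 < ε) (E : Set X)
    (n : ℕ) :
    bowenCn f E s (3 * ε) n ≤ packPre f s n ε E := by
  classical
  let P : Finset X → Prop := fun S => (S : Set X) ⊆ E ∧
    (S : Set X).Pairwise fun x y => Disjoint (dynCBall f x n ε) (dynCBall f y n ε)
  have hsep : ∀ S, P S → IsDynSep f E n ε ↑S := by
    rintro S ⟨h1, h2⟩
    refine ⟨h1, fun x hx y hy hxy => ?_⟩
    by_contra hcon
    simp only [not_exists, not_and, not_lt] at hcon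
    exact Set.disjoint_left.1 (h2 hx hy hxy) (show y ∈ dynCBall f x n ε from hcon)
      (fun i _ => by simpa using hε.le)
  obtain ⟨T, hT⟩ := exists_card_le_of_isDynSep hf E n hε
  obtain ⟨S, hS, hmax⟩ : ∃ S, P S ∧ ∀ S', P S' → S'.card ≤ S.card := by
    have hmem := Nat.sSup_mem (s := {k | ∃ S : Finset X, P S ∧ S.card = k})
      ⟨0, ∅, ⟨by simp, by simp⟩, rfl⟩ ⟨T, by rintro k ⟨S, hS, rfl⟩; exact hT S (hsep S hS)⟩
    obtain ⟨S, hS, hc⟩ := hmem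
    refine ⟨S, hS, fun S' hS' => ?_⟩
    rw [hc]
    exact le_csSup ⟨T, by rintro k ⟨S, hS, rfl⟩; exact hT S (hsep S hS)⟩ ⟨S', hS', rfl⟩
  have hcov : E ⊆ ⋃ x ∈ S, dynBall f x n (3 * ε) := by
    intro x hx
    by_contra hcon
    have hcon' : ∀ y ∈ S, ∃ i < n, 3 * ε ≤ dist (f^[i] y) (f^[i] x) := by
      simpa [dynBall] using hcon
    have hx' : x ∉ S := fun h => by
      obtain ⟨i, _, h2⟩ := hcon' x h
      simp only [dist_self] at h2
      linarith
    have hd : ∀ y ∈ S, Disjoint (dynCBall f x n ε) (dynCBall f y n ε) := by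
      intro y hy
      obtain ⟨i, hi, h2⟩ := hcon' y hy
      refine Set.disjoint_left.2 fun z hz1 hz2 => ?_
      have h3 := hz1 i hi
      have h4 := hz2 i hi
      have := dist_triangle_right (f^[i] y) (f^[i] x) (f^[i] z)
      linarith
    have h5 := hmax (insert x S) ⟨by simpa [insert_subset_iff] using ⟨hx, hS.1⟩, by
      rw [Finset.coe_insert]
      exact hS.2.insert fun y hy _ => ⟨hd y hy, (hd y hy).symm⟩⟩
    rw [Finset.card_insert_of_notMem hx'] at h5
    omega
  refine (bowenCn_le_of_cover S hcov).trans ?_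
  refine le_trans ?_ (le_iSup₂_of_le ((S ×ˢ {n} : Finset (X × ℕ)) : Set (X × ℕ))
    (Finset.countable_toSet _) <| le_iSup₂_of_le ?_ ?_ le_rfl)
  · rw [Finset.tsum_subtype' (S ×ˢ {n} : Finset (X × ℕ))
      (fun p : X × ℕ => ENNReal.ofReal (Real.exp (-s * (p.2 : ℝ)))), Finset.sum_product]
    simp
  · rintro ⟨x, k⟩ h
    simp only [Finset.coe_product, Finset.coe_singleton, mem_prod, mem_singleton_iff] at h
    exact ⟨hS.1 h.1, h.2.ge⟩
  · rintro ⟨x, k⟩ h ⟨y, l⟩ h' hne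
    simp only [Finset.coe_product, Finset.coe_singleton, mem_prod, mem_singleton_iff] at h h'
    obtain ⟨h1, rfl⟩ := h
    obtain ⟨h2, rfl⟩ := h'
    exact hS.2 h1 h2 fun hxy => hne (by rw [hxy])

lemma bowenCn_iUnion_le {s σ : ℝ} (n : ℕ) (C : ℕ → Set X) {E : Set X} (hE : E ⊆ ⋃ i, C i) :
    bowenCn f E s σ n ≤ ∑' i, bowenCn f (C i) s σ n := by
  refine ENNReal.le_of_forall_pos_le_add fun δ hδ hfin => ?_
  obtain ⟨δ', hδ', hsum⟩ := ENNReal.exists_pos_sum_of_countable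
    (ENNReal.coe_pos.2 hδ).ne' ℕ
  have hex : ∀ i, ∃ t : Set (X × ℕ), t.Countable ∧ (∀ p ∈ t, n ≤ p.2) ∧
      C i ⊆ (⋃ p ∈ t, dynBall f p.1 p.2 σ) ∧ bowenSum s t < bowenCn f (C i) s σ n + δ' i := by
    intro i
    have hne : bowenCn f (C i) s σ n ≠ ∞ := ENNReal.ne_top_of_tsum_ne_top hfin.ne i
    have hlt : bowenCn f (C i) s σ n < bowenCn f (C i) s σ n + δ' i :=
      ENNReal.lt_add_right hne (ENNReal.coe_pos.2 (hδ' i)).ne'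
    conv_lhs at hlt => rw [bowenCn]
    simp only [iInf_lt_iff] at hlt
    obtain ⟨t, h1, h2, h3, h4⟩ := hlt
    exact ⟨t, h1, h2, h3, h4⟩
  choose t h1 h2 h3 h4 using hex
  calc bowenCn f E s σ n ≤ bowenSum s (⋃ i, t i) := by
        refine iInf₂_le_of_le (⋃ i, t i) (countable_iUnion h1) <| iInf₂_le_of_le ?_ ?_ le_rfl
        · intro p hp
          obtain ⟨i, hi⟩ := mem_iUnion.1 hp
          exact h2 i p hi
        · intro x hx
          obtain ⟨i, hi⟩ := mem_iUnion.1 (hE hx)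
          obtain ⟨p, hp, hxp⟩ := mem_iUnion₂.1 (h3 i hi)
          exact mem_iUnion₂.2 ⟨p, mem_iUnion.2 ⟨i, hp⟩, hxp⟩
    _ ≤ ∑' i, bowenSum s (t i) :=
        ENNReal.tsum_iUnion_le_tsum (fun p : X × ℕ => ENNReal.ofReal (Real.exp (-s * (p.2 : ℝ)))) t
    _ ≤ ∑' i, (bowenCn f (C i) s σ n + δ' i) := ENNReal.tsum_le_tsum fun i => (h4 i).le
    _ ≤ _ := by rw [ENNReal.tsum_add]; gcongr

lemma bowenEnt_le_packEnt [CompactSpace X] (hf : Continuous f) (E : Set X) :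
    bowenEnt f E ≤ packEnt f E := by
  refine iSup₂_le fun σ hσ => le_iSup₂_of_le (σ / 3) (by positivity) ?_
  refine sInf_le_sInf ?_
  rintro _ ⟨s, rfl, hs⟩
  refine ⟨s, rfl, ENNReal.iSup_eq_zero.2 fun n => le_antisymm ?_ bot_le⟩
  rw [← hs]
  refine le_iInf₂ fun C hC => (bowenCn_iUnion_le n C hC).trans (ENNReal.tsum_le_tsum fun i => ?_)
  refine le_iInf fun N => ?_
  have h3 : 3 * (σ / 3) = σ := by ring
  have hmono : ∀ n m : ℕ, n ≤ m → bowenCn f (C i) s σ n ≤ bowenCn f (C i) s σ m := fun n m hnm =>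
    iInf_mono fun t => iInf_mono fun _ => iInf_mono' fun h =>
      ⟨fun p hp => hnm.trans (h p hp), le_rfl⟩
  have hanti : packPre f s (max n N) (σ / 3) (C i) ≤ packPre f s N (σ / 3) (C i) :=
    iSup_mono fun D => iSup_mono fun _ => iSup_mono' fun h =>
      ⟨fun p hp => ⟨(h p hp).1, (le_max_right n N).trans (h p hp).2⟩, le_rfl⟩
  refine (hmono n (max n N) (le_max_left _ _)).trans (le_trans ?_ hanti)
  have := bowenCn_le_packPre hf (s := s) (ε := σ / 3) (by positivity) (C i) (max n N)
  rwa [h3] at this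

/-- A compact subset of `E` of large Bowen entropy forces all three entropies of `E`. -/
lemma entropies_eq_topEnt_univ [CompactSpace X] (hf : Continuous f) {E : Set X}
    (h : ∀ t : ℝ, (t : EReal) < topEnt f univ →
      ∃ K ⊆ E, IsCompact K ∧ (t : EReal) ≤ bowenEnt f K) :
    bowenEnt f E = topEnt f univ ∧ topEnt f E = topEnt f univ ∧ packEnt f E = topEnt f univ := by
  have hB : topEnt f univ ≤ bowenEnt f E := EReal.ge_of_forall_gt_iff_ge.1 fun t ht => by
    obtain ⟨K, hK, _, hle⟩ := h t ht
    exact hle.trans (bowenEnt_mono hK)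
  have hT : topEnt f univ ≤ topEnt f E := EReal.ge_of_forall_gt_iff_ge.1 fun t ht => by
    obtain ⟨K, hK, hc, hle⟩ := h t ht
    exact hle.trans ((bowenEnt_le_compactEnt hf K).trans
      (le_iSup_of_le K <| le_iSup_of_le hc <| le_iSup_of_le hK le_rfl))
  refine ⟨le_antisymm ?_ hB, le_antisymm ?_ hT,
    le_antisymm ?_ (hB.trans (bowenEnt_le_packEnt hf E))⟩
  · rw [topEnt_univ_eq hf]
    exact (bowenEnt_le_compactEnt hf E).trans (compactEnt_mono hf (subset_univ E))
  · exact iSup_mono fun K => iSup_mono fun _ => iSup_mono' fun _ => ⟨subset_univ _, le_rfl⟩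
  · rw [topEnt_univ_eq hf]; exact packEnt_le_compactEnt_univ hf E

end EntropyComparison

section CocycleGrowth

variable {X : Type*} {m : ℕ} {f : X → X} {A : X → (Em m ≃L[ℝ] Em m)} {c : ℝ}

/-- `log ‖A(x,n)‖`. -/
noncomputable def cocycleLog (f : X → X) (A : X → (Em m ≃L[ℝ] Em m)) (n : ℕ) (x : X) : ℝ :=
  Real.log ‖cocycle f A x n‖

/-- The generator `A` and its inverse have norm at most `e^c`. -/
def NormLogBound (A : X → (Em m ≃L[ℝ] Em m)) (c : ℝ) : Prop :=
  0 ≤ c ∧ ∀ x, ‖(A x : Em m →L[ℝ] Em m)‖ ≤ Real.exp c ∧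
    ‖((A x).symm : Em m →L[ℝ] Em m)‖ ≤ Real.exp c

lemma cocycle_add (f : X → X) (A : X → (Em m ≃L[ℝ] Em m)) (x : X) (n k : ℕ) :
    cocycle f A x (n + k) = (cocycle f A (f^[n] x) k).comp (cocycle f A x n) := by
  induction k with
  | zero => rfl
  | succ k ih =>
    rw [← add_assoc, cocycle, ih, cocycle, ← Function.iterate_add_apply, Nat.add_comm k n]
    rfl

namespace NormLogBound

lemma norm_cocycle_le (hc : NormLogBound A c) (x : X) (n : ℕ) :
    ‖cocycle f A x n‖ ≤ Real.exp (c * n) := by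
  induction n with
  | zero => simpa [cocycle] using ContinuousLinearMap.norm_id_le
  | succ n ih =>
    rw [cocycle]
    refine (ContinuousLinearMap.opNorm_comp_le _ _).trans ?_
    calc _ ≤ Real.exp c * Real.exp (c * n) := by gcongr; exact (hc.2 _).1
      _ = _ := by rw [← Real.exp_add]; push_cast; ring_nf

lemma norm_le_comp_left (hc : NormLogBound A c) (x : X) (n : ℕ) (T : Em m →L[ℝ] Em m) :
    ‖T‖ ≤ Real.exp (c * n) * ‖(cocycle f A x n).comp T‖ := by
  induction n with
  | zero => simp [cocycle]
  | succ n ih =>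
    have h1 : (cocycle f A x n).comp T = ((A (f^[n] x)).symm : Em m →L[ℝ] Em m).comp
        ((cocycle f A x (n + 1)).comp T) := by
      ext v; simp [cocycle]
    calc ‖T‖ ≤ Real.exp (c * n) * (Real.exp c * ‖(cocycle f A x (n + 1)).comp T‖) := by
          refine ih.trans ?_
          rw [h1]
          gcongr
          refine (ContinuousLinearMap.opNorm_comp_le _ _).trans ?_
          gcongr
          exact (hc.2 _).2
      _ = _ := by rw [← mul_assoc, ← Real.exp_add]; push_cast; ring_nf

lemma norm_le_comp_right (hc : NormLogBound A c) (x : X) (n : ℕ) (T : Em m →L[ℝ] Em m) :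
    ‖T‖ ≤ ‖T.comp (cocycle f A x n)‖ * Real.exp (c * n) := by
  induction n generalizing T with
  | zero => simp [cocycle]
  | succ n ih =>
    have h1 : T = (T.comp (A (f^[n] x) : Em m →L[ℝ] Em m)).comp
        ((A (f^[n] x)).symm : Em m →L[ℝ] Em m) := by
      ext v; simp
    have h2 : (T.comp (A (f^[n] x) : Em m →L[ℝ] Em m)).comp (cocycle f A x n)
        = T.comp (cocycle f A x (n + 1)) := rfl
    calc ‖T‖ ≤ (‖T.comp (cocycle f A x (n + 1))‖ * Real.exp (c * n)) * Real.exp c := by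
          conv_lhs => rw [h1]
          refine (ContinuousLinearMap.opNorm_comp_le _ _).trans ?_
          rw [← h2]
          gcongr
          · exact ih _
          · exact (hc.2 _).2
      _ = _ := by rw [mul_assoc, ← Real.exp_add]; push_cast; ring_nf

variable [NeZero m]

lemma norm_cocycle_pos (hc : NormLogBound A c) (x : X) (n : ℕ) : 0 < ‖cocycle f A x n‖ := by
  have h := hc.norm_le_comp_left (f := f) x n (ContinuousLinearMap.id ℝ (Em m))
  rw [ContinuousLinearMap.norm_id, ContinuousLinearMap.comp_id] at h
  exact pos_of_mul_pos_right (lt_of_lt_of_le one_pos h) (Real.exp_pos _).le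

lemma exp_cocycleLog (hc : NormLogBound A c) (x : X) (n : ℕ) :
    Real.exp (cocycleLog f A n x) = ‖cocycle f A x n‖ :=
  Real.exp_log (hc.norm_cocycle_pos x n)

lemma cocycleLog_add_le (hc : NormLogBound A c) (x : X) (n k : ℕ) :
    cocycleLog f A (n + k) x ≤ cocycleLog f A n x + cocycleLog f A k (f^[n] x) := by
  rw [← Real.exp_le_exp, Real.exp_add, hc.exp_cocycleLog, hc.exp_cocycleLog, hc.exp_cocycleLog,
    cocycle_add, mul_comm]
  exact ContinuousLinearMap.opNorm_comp_le _ _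

lemma cocycleLog_iterate_le (hc : NormLogBound A c) (x : X) (n k : ℕ) :
    cocycleLog f A k (f^[n] x) ≤ cocycleLog f A (n + k) x + c * n := by
  rw [← Real.exp_le_exp, Real.exp_add, hc.exp_cocycleLog, hc.exp_cocycleLog, cocycle_add]
  exact hc.norm_le_comp_right _ _ _

lemma cocycleLog_le_add (hc : NormLogBound A c) (x : X) (n k : ℕ) :
    cocycleLog f A n x ≤ cocycleLog f A (n + k) x + c * k := by
  rw [← Real.exp_le_exp, Real.exp_add, hc.exp_cocycleLog, hc.exp_cocycleLog, cocycle_add, mul_comm]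
  exact hc.norm_le_comp_left _ _ _

lemma abs_cocycleLog_le (hc : NormLogBound A c) (n : ℕ) (x : X) :
    |cocycleLog f A n x| ≤ c * n := by
  have h0 : cocycleLog f A 0 x = 0 := by
    simp [cocycleLog, cocycle, ContinuousLinearMap.norm_id]
  have h1 := hc.cocycleLog_le_add (f := f) x 0 n
  rw [h0, zero_add] at h1
  refine abs_le.2 ⟨by linarith, ?_⟩
  rw [← Real.exp_le_exp, hc.exp_cocycleLog]
  exact hc.norm_cocycle_le x n

lemma abs_cocycleLog_div_le (hc : NormLogBound A c) (n : ℕ) (x : X) :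
    |cocycleLog f A n x / n| ≤ c := by
  rw [abs_div, Nat.abs_cast]
  exact div_le_of_le_mul₀ (Nat.cast_nonneg _) hc.1 (hc.abs_cocycleLog_le n x)

end NormLogBound

lemma abs_birkhoffSum_le {φ : X → ℝ} (hφ : ∀ x, |φ x| ≤ c) (n : ℕ) (x : X) :
    |birkhoffSum f φ n x| ≤ c * n := by
  refine (Finset.abs_sum_le_sum_abs _ _).trans ?_
  refine (Finset.sum_le_sum fun i _ => hφ _).trans ?_
  simp [mul_comm]

lemma abs_birkhoffSum_sub_le {φ : X → ℝ} {ε : ℝ} {n : ℕ} {x y : X}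
    (h : ∀ i < n, |φ (f^[i] x) - φ (f^[i] y)| ≤ ε) :
    |birkhoffSum f φ n x - birkhoffSum f φ n y| ≤ n * ε := by
  rw [birkhoffSum, birkhoffSum, ← Finset.sum_sub_distrib]
  refine (Finset.abs_sum_le_sum_abs _ _).trans ?_
  refine (Finset.sum_le_sum fun i hi => h i (Finset.mem_range.1 hi)).trans ?_
  simp

namespace NormLogBound

variable [NeZero m]

lemma sum_cocycleLog_iterate_le (hc : NormLogBound A c) (N k : ℕ) (x : X) :
    ∑ r ∈ Finset.range N, cocycleLog f A (k * N) (f^[r] x)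
      ≤ birkhoffSum f (cocycleLog f A N) (k * N) x := by
  induction k with
  | zero => simp [cocycleLog, cocycle, ContinuousLinearMap.norm_id]
  | succ k ih =>
    rw [Nat.succ_mul, birkhoffSum_add]
    calc _ ≤ ∑ r ∈ Finset.range N, (cocycleLog f A (k * N) (f^[r] x)
          + cocycleLog f A N (f^[r] (f^[k * N] x))) := by
          refine Finset.sum_le_sum fun r _ => ?_
          refine (hc.cocycleLog_add_le (f^[r] x) (k * N) N).trans_eq ?_
          rw [← Function.iterate_add_apply, ← Function.iterate_add_apply, add_comm r]
      _ ≤ _ := by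
          rw [Finset.sum_add_distrib]
          exact add_le_add ih le_rfl

/-- The growth of the cocycle is bounded above by Birkhoff sums of its finite-time averages. -/
lemma cocycleLog_le_birkhoffSum (hc : NormLogBound A c) {N : ℕ} (hN : 0 < N) (n : ℕ) (x : X) :
    cocycleLog f A n x ≤ birkhoffSum f (fun y => cocycleLog f A N y / N) n x + 4 * c * N := by
  have hN' : (0 : ℝ) < N := by exact_mod_cast hN
  have hc0 := hc.1
  set k := n / N
  set s := n % N
  have hn : n = k * N + s := by rw [mul_comm]; exact (Nat.div_add_mod n N).symm
  have hs : (s : ℝ) ≤ N := by exact_mod_cast (Nat.mod_lt n hN).le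
  have h1 : ∀ r ∈ Finset.range N, cocycleLog f A (k * N) x
      ≤ cocycleLog f A (k * N) (f^[r] x) + 2 * c * N := by
    intro r hr
    have hr' : (r : ℝ) ≤ N := by exact_mod_cast (Finset.mem_range.1 hr).le
    have h2 := hc.cocycleLog_le_add (f := f) x (k * N) r
    have h3 := hc.cocycleLog_add_le (f := f) x r (k * N)
    have h4 := (abs_le.1 (hc.abs_cocycleLog_le (f := f) r x)).2
    rw [add_comm r] at h3
    have : c * r ≤ c * N := by gcongr
    linarith
  have h2 : (N : ℝ) * cocycleLog f A (k * N) x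
      ≤ birkhoffSum f (cocycleLog f A N) (k * N) x + N * (2 * c * N) := by
    have := Finset.sum_le_sum h1
    rw [Finset.sum_const, Finset.card_range, nsmul_eq_mul, Finset.sum_add_distrib,
      Finset.sum_const, Finset.card_range, nsmul_eq_mul] at this
    linarith [hc.sum_cocycleLog_iterate_le (f := f) N k x]
  have h3 : birkhoffSum f (fun y => cocycleLog f A N y / N) (k * N) x
      = birkhoffSum f (cocycleLog f A N) (k * N) x / N := by
    simp only [birkhoffSum, Finset.sum_div]
  have h4 : cocycleLog f A (k * N) x
      ≤ birkhoffSum f (fun y => cocycleLog f A N y / N) (k * N) x + 2 * c * N := by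
    rw [h3]
    rw [← mul_le_mul_iff_right₀ hN']
    calc _ ≤ _ := h2
      _ = _ := by field_simp
  have h5 := hc.cocycleLog_add_le (f := f) x (k * N) s
  have h6 := (abs_le.1 (hc.abs_cocycleLog_le (f := f) s (f^[k * N] x))).2
  have h7 := (abs_le.1 (abs_birkhoffSum_le (f := f)
    (hc.abs_cocycleLog_div_le (f := f) N) s (f^[k * N] x))).1
  have h8 : c * s ≤ c * N := by gcongr
  rw [hn, birkhoffSum_add]
  linarith

end NormLogBound

lemma HolderMat.continuous [MetricSpace X] (hA : HolderMat A) :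
    Continuous fun x => (A x : Em m →L[ℝ] Em m) := by
  obtain ⟨α, C, hα, hC, h⟩ := hA
  refine continuous_iff_continuousAt.2 fun x => tendsto_iff_norm_sub_tendsto_zero.2 ?_
  have h1 : Tendsto (fun y => C * dist y x ^ α) (𝓝 x) (𝓝 0) := by
    have h2 : Continuous fun y => C * dist y x ^ α :=
      continuous_const.mul ((continuous_id.dist continuous_const).rpow_const fun _ => Or.inr hα.le)
    have := h2.tendsto x
    simpa [Real.zero_rpow hα.ne'] using this
  exact squeeze_zero (fun _ => norm_nonneg _) (fun y => h y x) h1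

lemma HolderMat.exists_normLogBound [MetricSpace X] [CompactSpace X] (hA : HolderMat A) :
    ∃ c, NormLogBound A c := by
  have h1 := hA.continuous
  have h2 : Continuous fun x => ((A x).symm : Em m →L[ℝ] Em m) := by
    have : (fun x => ((A x).symm : Em m →L[ℝ] Em m))
        = fun x => ContinuousLinearMap.inverse (A x : Em m →L[ℝ] Em m) := by
      ext1 x; simp
    rw [this]
    refine continuous_iff_continuousAt.2 fun x => ?_
    have h3 : ContinuousAt ContinuousLinearMap.inverse (A x : Em m →L[ℝ] Em m) :=
      (contDiffAt_map_inverse (n := 0) (𝕜 := ℝ) (A x)).continuousAt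
    exact ContinuousAt.comp (f := fun x => (A x : Em m →L[ℝ] Em m)) h3 h1.continuousAt
  obtain ⟨C1, hC1⟩ := isCompact_univ.exists_bound_of_continuousOn h1.continuousOn
  obtain ⟨C2, hC2⟩ := isCompact_univ.exists_bound_of_continuousOn h2.continuousOn
  refine ⟨max 0 (max C1 C2), le_max_left _ _, fun x => ?_⟩
  have h4 := Real.add_one_le_exp (max 0 (max C1 C2))
  have h5 : C1 ≤ max 0 (max C1 C2) := (le_max_left _ _).trans (le_max_right _ _)
  have h6 : C2 ≤ max 0 (max C1 C2) := (le_max_right _ _).trans (le_max_right _ _)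
  exact ⟨by linarith [hC1 x (mem_univ x)], by linarith [hC2 x (mem_univ x)]⟩

lemma continuous_cocycle [TopologicalSpace X] (hf : Continuous f)
    (hA : Continuous fun x => (A x : Em m →L[ℝ] Em m)) (n : ℕ) :
    Continuous fun x => cocycle f A x n := by
  induction n with
  | zero => exact continuous_const
  | succ n ih => exact (hA.comp (hf.iterate n)).clm_comp ih

lemma NormLogBound.continuous_cocycleLog [NeZero m] [TopologicalSpace X] (hc : NormLogBound A c)
    (hf : Continuous f) (hA : Continuous fun x => (A x : Em m →L[ℝ] Em m)) (n : ℕ) :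
    Continuous (cocycleLog f A n) :=
  (continuous_cocycle hf hA n).norm.log fun x => (hc.norm_cocycle_pos x n).ne'

end CocycleGrowth

section InvariantMeasures

/-- The uniform measure on the orbit segment `w, f w, …, f^{T-1} w`. -/
noncomputable def empiricalMeasure {X : Type*} [MeasurableSpace X] (f : X → X) (w : X) (T : ℕ) :
    Measure X :=
  ENNReal.ofReal ((T : ℝ)⁻¹) • ∑ i ∈ Finset.range T, Measure.dirac (f^[i] w)

lemma isProbabilityMeasure_empiricalMeasure {X : Type*} [MeasurableSpace X] (f : X → X)
    (w : X) {T : ℕ} (hT : 0 < T) :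
    IsProbabilityMeasure (empiricalMeasure f w T) := by
  constructor
  have hT' : (0 : ℝ) < T := by exact_mod_cast hT
  simp only [empiricalMeasure, Measure.smul_apply, Measure.finsetSum_apply, measure_univ,
    Finset.sum_const, Finset.card_range, nsmul_eq_mul, mul_one, smul_eq_mul]
  rw [ENNReal.ofReal_inv_of_pos hT', ENNReal.ofReal_natCast]
  exact ENNReal.inv_mul_cancel (by exact_mod_cast hT.ne') (ENNReal.natCast_ne_top _)

lemma isClosed_setOf_measurePreserving {X : Type*} [MetricSpace X] [MeasurableSpace X]
    [BorelSpace X] {f : X → X} (hf : Continuous f) :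
    IsClosed {μ : ProbabilityMeasure X | MeasurePreserving f (μ : Measure X) (μ : Measure X)} := by
  have h : {μ : ProbabilityMeasure X | MeasurePreserving f (μ : Measure X) (μ : Measure X)}
      = {μ | μ.map hf.aemeasurable = μ} := by
    ext μ
    constructor
    · intro h
      exact Subtype.ext h.map_eq
    · intro h
      exact ⟨hf.measurable, congrArg Subtype.val h⟩
  rw [h]
  exact isClosed_eq (ProbabilityMeasure.continuous_map hf) continuous_id

variable {X : Type*} [MetricSpace X] [CompactSpace X] [MeasurableSpace X] [BorelSpace X]
  {m : ℕ} [NeZero m] {f : X → X} {A : X → (Em m ≃L[ℝ] Em m)} {c : ℝ}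

lemma Continuous.integrable_of_compactSpace {φ : X → ℝ} (hφ : Continuous φ) (μ : Measure X)
    [IsFiniteMeasure μ] : Integrable φ μ :=
  hφ.integrable_of_hasCompactSupport (HasCompactSupport.of_compactSpace φ)

lemma integral_birkhoffSum {μ : Measure X} [IsProbabilityMeasure μ]
    (hμ : MeasurePreserving f μ μ) (hf : Continuous f) {φ : X → ℝ} (hφ : Continuous φ) (n : ℕ) :
    ∫ x, birkhoffSum f φ n x ∂μ = n * ∫ x, φ x ∂μ := by
  simp only [birkhoffSum]
  rw [integral_finsetSum (f := fun i x => φ (f^[i] x)) _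
    fun i _ => (hφ.comp (hf.iterate i)).integrable_of_compactSpace μ]
  have h : ∀ i, ∫ x, φ (f^[i] x) ∂μ = ∫ x, φ x ∂μ := fun i => by
    have h1 := (hμ.iterate i).map_eq
    conv_rhs => rw [← h1]
    rw [integral_map (hμ.iterate i).aemeasurable hφ.aestronglyMeasurable]
  simp [h]

lemma NormLogBound.mle_le (hc : NormLogBound A c) (hf : Continuous f)
    (hA : Continuous fun x => (A x : Em m →L[ℝ] Em m)) (μ : Measure X) [IsProbabilityMeasure μ]
    {n : ℕ} (hn : 0 < n) : mle f A μ ≤ (∫ x, cocycleLog f A n x ∂μ) / n := by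
  obtain ⟨k, rfl⟩ : ∃ k, n = k + 1 := ⟨n - 1, by omega⟩
  have hbdd : BddBelow (range fun n : ℕ =>
      (∫ x, Real.log ‖cocycle f A x (n + 1)‖ ∂μ) / ((n : ℝ) + 1)) := by
    refine ⟨-c, ?_⟩
    rintro _ ⟨n, rfl⟩
    have hn : (0 : ℝ) < (n : ℝ) + 1 := by positivity
    simp only
    rw [le_div_iff₀ hn]
    have h1 : ∫ _, -c * ((n : ℝ) + 1) ∂μ ≤ ∫ x, cocycleLog f A (n + 1) x ∂μ :=
      integral_mono (integrable_const _)
        ((hc.continuous_cocycleLog hf hA (n + 1)).integrable_of_compactSpace μ)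
        fun x => by
          have := (abs_le.1 (hc.abs_cocycleLog_le (f := f) (n + 1) x)).1
          push_cast at this
          simpa using this
    simpa [cocycleLog] using h1
  have := ciInf_le hbdd k
  simpa [mle, cocycleLog] using this

lemma NormLogBound.integral_cocycleLog_div_le (hc : NormLogBound A c) (hf : Continuous f)
    (hA : Continuous fun x => (A x : Em m →L[ℝ] Em m)) {μ : Measure X} [IsProbabilityMeasure μ]
    (hμ : MeasurePreserving f μ μ) {n M : ℕ} (hn : 0 < n) (hM : 0 < M) :
    (∫ x, cocycleLog f A M x ∂μ) / M
      ≤ (∫ x, cocycleLog f A n x ∂μ) / n + 4 * c * n / M := by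
  have hM' : (0 : ℝ) < M := by exact_mod_cast hM
  have hφ := (hc.continuous_cocycleLog hf hA n).div_const (n : ℝ)
  have h1 : ∫ x, cocycleLog f A M x ∂μ
      ≤ ∫ x, (birkhoffSum f (fun y => cocycleLog f A n y / n) M x + 4 * c * n) ∂μ := by
    refine integral_mono ((hc.continuous_cocycleLog hf hA M).integrable_of_compactSpace μ) ?_
      fun x => hc.cocycleLog_le_birkhoffSum hn M x
    refine Continuous.integrable_of_compactSpace ?_ μ
    refine Continuous.add ?_ continuous_const
    exact continuous_finsetSum _ fun i _ => hφ.comp (hf.iterate i)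
  rw [integral_add _ (integrable_const _), integral_birkhoffSum hμ hf hφ, integral_div] at h1
  · rw [div_le_iff₀ hM', add_mul, div_mul_cancel₀ _ hM'.ne']
    simp only [integral_const, probReal_univ, one_smul] at h1
    linarith
  · exact Continuous.integrable_of_compactSpace
      (continuous_finsetSum _ fun i _ => hφ.comp (hf.iterate i)) μ

/-- Lower semicontinuity of the exponent makes the finite-time exponents converge uniformly
on the invariant measures. -/
lemma NormLogBound.exists_integral_cocycleLog_le (hc : NormLogBound A c) (hf : Continuous f)
    (hA : Continuous fun x => (A x : Em m →L[ℝ] Em m))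
    (hlsc : LowerSemicontinuousOn (fun μ : ProbabilityMeasure X => mle f A (μ : Measure X))
      {μ : ProbabilityMeasure X | MeasurePreserving f (μ : Measure X) (μ : Measure X)})
    {ε : ℝ} (hε : 0 < ε) :
    ∃ N : ℕ, 0 < N ∧ ∀ μ : ProbabilityMeasure X,
      MeasurePreserving f (μ : Measure X) (μ : Measure X) →
      (∫ x, cocycleLog f A N x ∂(μ : Measure X)) / N ≤ mle f A (μ : Measure X) + ε := by
  by_contra! hcon
  choose μ hμ hlt using fun N : ℕ => hcon (N + 1) N.succ_pos
  let U : Ultrafilter ℕ := hyperfilter ℕ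
  have hU : (U : Filter ℕ) ≤ atTop := Nat.hyperfilter_le_atTop
  obtain ⟨ν, -, hν⟩ := isCompact_univ.ultrafilter_le_nhds (U.map μ) (by simp)
  have hν : Tendsto μ U (𝓝 ν) := hν
  have hνinv : ν ∈ {μ : ProbabilityMeasure X |
      MeasurePreserving f (μ : Measure X) (μ : Measure X)} :=
    (isClosed_setOf_measurePreserving hf).mem_of_tendsto hν (Eventually.of_forall hμ)
  obtain ⟨n, hn⟩ : ∃ n : ℕ, (∫ x, Real.log ‖cocycle f A x (n + 1)‖ ∂(ν : Measure X)) /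
      ((n : ℝ) + 1) < mle f A (ν : Measure X) + ε / 4 :=
    exists_lt_of_ciInf_lt (lt_add_of_pos_right _ (by positivity))
  have h1 : ∀ᶠ k in (U : Filter ℕ),
      mle f A (ν : Measure X) - ε / 4 < mle f A (μ k : Measure X) := by
    have := hlsc ν hνinv (mle f A (ν : Measure X) - ε / 4) (by simp only; linarith)
    exact (tendsto_nhdsWithin_iff.2 ⟨hν, Eventually.of_forall hμ⟩).eventually this
  have h2 : Tendsto (fun k => (∫ x, cocycleLog f A (n + 1) x ∂(μ k : Measure X)) /
      ((n + 1 : ℕ) : ℝ)) U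
      (𝓝 ((∫ x, cocycleLog f A (n + 1) x ∂(ν : Measure X)) / ((n + 1 : ℕ) : ℝ))) := by
    refine Tendsto.div_const ?_ _
    let g : C(X, ℝ) := ⟨_, hc.continuous_cocycleLog hf hA (n + 1)⟩
    exact ((ProbabilityMeasure.continuous_integral_continuousMap g).tendsto ν).comp hν
  have h3 : ∀ᶠ k in (U : Filter ℕ), (∫ x, cocycleLog f A (n + 1) x ∂(μ k : Measure X)) /
      ((n + 1 : ℕ) : ℝ) < mle f A (ν : Measure X) + ε / 4 := by
    refine h2.eventually_lt_const ?_
    push_cast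
    exact hn
  have h4 : ∀ᶠ k in (U : Filter ℕ), 4 * c * ((n + 1 : ℕ) : ℝ) / ((k + 1 : ℕ) : ℝ) < ε / 4 := by
    have : Tendsto (fun k : ℕ => 4 * c * ((n + 1 : ℕ) : ℝ) / ((k + 1 : ℕ) : ℝ)) atTop (𝓝 0) :=
      (tendsto_const_div_atTop_nhds_zero_nat _).comp (tendsto_add_atTop_nat 1)
    exact (this.eventually_lt_const (by positivity)).filter_mono hU
  obtain ⟨k, hk1, hk3, hk4⟩ := (h1.and (h3.and h4)).exists
  have h5 := hc.integral_cocycleLog_div_le hf hA (hμ k) n.succ_pos k.succ_pos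
  have h6 := hlt k
  simp only [Nat.succ_eq_add_one] at h5
  linarith

lemma integral_empiricalMeasure (f : X → X) (w : X) (T : ℕ) {φ : X → ℝ} (hφ : Continuous φ) :
    ∫ x, φ x ∂(empiricalMeasure f w T) = birkhoffSum f φ T w / T := by
  rw [empiricalMeasure, integral_smul_measure, integral_finsetSum_measure
    fun i _ => hφ.integrable_of_compactSpace _]
  simp only [integral_dirac]
  rw [ENNReal.toReal_ofReal (by positivity), smul_eq_mul, birkhoffSum, div_eq_inv_mul]

/-- An invariant measure obtained as a limit of empirical measures of one orbit. -/
lemma exists_invariant_tendsto_birkhoffSum (hf : Continuous f) (w : X) {T : ℕ → ℕ}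
    (hT : Tendsto T atTop atTop) :
    ∃ (μ : ProbabilityMeasure X) (U : Ultrafilter ℕ), (U : Filter ℕ) ≤ atTop ∧
      MeasurePreserving f (μ : Measure X) (μ : Measure X) ∧
      ∀ φ : X → ℝ, Continuous φ →
        Tendsto (fun k => birkhoffSum f φ (T k) w / T k) U (𝓝 (∫ x, φ x ∂(μ : Measure X))) := by
  let e : ℕ → ProbabilityMeasure X := fun k => if h : 0 < T k then
    ⟨empiricalMeasure f w (T k), isProbabilityMeasure_empiricalMeasure f w h⟩
    else ⟨Measure.dirac w, inferInstance⟩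
  have he : ∀ k, 0 < T k → (e k : Measure X) = empiricalMeasure f w (T k) := fun k hk => by
    simp [e, hk]
  let U : Ultrafilter ℕ := hyperfilter ℕ
  have hU : (U : Filter ℕ) ≤ atTop := Nat.hyperfilter_le_atTop
  obtain ⟨μ, -, hμ⟩ := isCompact_univ.ultrafilter_le_nhds (U.map e) (by simp)
  have hμ : Tendsto e U (𝓝 μ) := hμ
  have hlim : ∀ φ : X → ℝ, Continuous φ →
      Tendsto (fun k => birkhoffSum f φ (T k) w / T k) U (𝓝 (∫ x, φ x ∂(μ : Measure X))) := by
    intro φ hφ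
    let g : C(X, ℝ) := ⟨φ, hφ⟩
    have h1 := ((ProbabilityMeasure.continuous_integral_continuousMap g).tendsto μ).comp hμ
    refine h1.congr' ?_
    filter_upwards [(hT.eventually_gt_atTop 0).filter_mono hU] with k hk
    simp only [Function.comp_apply, he k hk]
    exact integral_empiricalMeasure f w (T k) hφ
  refine ⟨μ, U, hU, ⟨hf.measurable, ?_⟩, hlim⟩
  have := Measure.isProbabilityMeasure_map (μ := (μ : Measure X)) hf.aemeasurable
  refine ext_of_forall_integral_eq_of_IsFiniteMeasure fun g => ?_
  rw [integral_map hf.aemeasurable g.continuous.aestronglyMeasurable]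
  have h1 := hlim _ (g.continuous.comp hf)
  have h2 := hlim _ g.continuous
  have h3 : Tendsto (fun k => birkhoffSum f (g ∘ f) (T k) w / T k - birkhoffSum f g (T k) w / T k)
      U (𝓝 0) := by
    have h4 : Tendsto (fun k => 2 * ‖g‖ / (T k : ℝ)) U (𝓝 0) :=
      ((tendsto_const_div_atTop_nhds_zero_nat _).comp hT).mono_left hU
    refine squeeze_zero_norm (fun k => ?_) h4
    have h5 : birkhoffSum f (g ∘ f) (T k) w = birkhoffSum f g (T k) (f w) := by
      simp only [birkhoffSum, Function.comp_apply, ← Function.iterate_succ_apply',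
        ← Function.iterate_succ_apply]
    rw [h5, ← sub_div, birkhoffSum_apply_sub_birkhoffSum, norm_div, Real.norm_natCast]
    gcongr
    refine (norm_sub_le _ _).trans ?_
    linarith [g.norm_coe_le_norm (f^[T k] w), g.norm_coe_le_norm w]
  have h6 := tendsto_nhds_unique h3 (h1.sub h2)
  simp only [Function.comp_apply] at h6
  linarith

end InvariantMeasures

section Gluing

variable {X : Type*} [MetricSpace X] [CompactSpace X]

lemma TopMixingOn.exists_connecting {f : X → X} (hmix : TopMixingOn f univ) {δ : ℝ}
    (hδ : 0 < δ) :
    ∃ N : ℕ, 0 < N ∧ ∀ x y : X, ∃ w, dist w x < δ ∧ dist (f^[N] w) y < δ := by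
  obtain ⟨t, ht⟩ := isCompact_univ.elim_finite_subcover (fun x : X => Metric.ball x (δ / 2))
    (fun x => Metric.isOpen_ball)
    (fun x _ => mem_iUnion.2 ⟨x, Metric.mem_ball_self (half_pos hδ)⟩)
  have h1 : ∀ a b : X, ∃ N : ℕ, ∀ n ≥ N,
      (f^[n] '' (Metric.ball a (δ / 2) ∩ univ) ∩ (Metric.ball b (δ / 2) ∩ univ)).Nonempty :=
    fun a b => hmix _ _ Metric.isOpen_ball Metric.isOpen_ball
      ⟨a, Metric.mem_ball_self (half_pos hδ), mem_univ _⟩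
      ⟨b, Metric.mem_ball_self (half_pos hδ), mem_univ _⟩
  choose N hN using h1
  refine ⟨(t ×ˢ t).sup (fun p => N p.1 p.2) + 1, Nat.succ_pos _, fun x y => ?_⟩
  obtain ⟨a, ha, hxa⟩ : ∃ a ∈ t, dist x a < δ / 2 := by simpa using ht (mem_univ x)
  obtain ⟨b, hb, hyb⟩ : ∃ b ∈ t, dist y b < δ / 2 := by simpa using ht (mem_univ y)
  have hle : N a b ≤ (t ×ˢ t).sup (fun p => N p.1 p.2) :=
    Finset.le_sup (f := fun p : X × X => N p.1 p.2) (Finset.mk_mem_product ha hb)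
  obtain ⟨v, ⟨w, ⟨hw, -⟩, rfl⟩, ⟨hv, -⟩⟩ := hN a b _ (hle.trans (Nat.le_succ _))
  rw [Metric.mem_ball] at hw hv
  refine ⟨w, ?_, ?_⟩
  · linarith [dist_triangle_right w x a]
  · exact lt_of_le_of_lt (dist_triangle_right _ y b)
      (by simp only [Nat.succ_eq_add_one] at hv; linarith)

lemma csum_alternating (n N i : ℕ) :
    csum (fun k : ℤ => if Even k then n else N) (2 * (i : ℤ)) = ((i * (n + N) : ℕ) : ℤ) := by
  have h0 : (0 : ℤ) ≤ 2 * (i : ℤ) := by positivity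
  have h1 : (2 * (i : ℤ)).toNat = 2 * i := by omega
  rw [csum, if_pos h0, h1]
  induction i with
  | zero => simp
  | succ i ih =>
    rw [Nat.mul_succ, Finset.sum_range_succ, Finset.sum_range_succ, ih (by positivity) (by omega)]
    have h2 : Even ((2 * i : ℕ) : ℤ) := by simp
    have h3 : ¬ Even ((2 * i + 1 : ℕ) : ℤ) := by
      rw [Int.even_coe_nat]; exact Nat.not_even_bit1 i
    rw [if_pos h2, if_neg h3]
    push_cast
    ring

/-- Exponential specification: orbit segments of a common length can be glued, with a fixed gap
between consecutive segments. -/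
lemma exists_glued_orbit {f : X ≃ₜ X} {lam : ℝ} (hmix : TopMixingOn (⇑f) univ)
    (hsh : ExpShadowingWith f.toEquiv lam) {τ : ℝ} (hτ : 0 < τ) :
    ∃ N : ℕ, 0 < N ∧ ∀ n : ℕ, 0 < n → ∀ y : ℕ → X, ∃ z : X, ∀ i j : ℕ, j < n →
      dist ((⇑f)^[i * (n + N) + j] z) ((⇑f)^[j] (y i))
        < τ * Real.exp (-lam * ((min j (n - j) : ℕ) : ℝ)) := by
  obtain ⟨δ, hδ, hshadow⟩ := hsh τ hτ
  obtain ⟨N, hN, hconn⟩ := hmix.exists_connecting hδ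
  choose w hw1 hw2 using hconn
  refine ⟨N, hN, fun n hn y => ?_⟩
  let Y : ℤ → X := fun i => y i.toNat
  let x : ℤ → X := fun k => if Even k then Y (k / 2) else w ((⇑f)^[n] (Y (k / 2))) (Y (k / 2 + 1))
  let s : ℤ → ℕ := fun k => if Even k then n else N
  have hpo : IsPseudoOrbit (⇑f.toEquiv) δ x s := by
    refine ⟨fun i => ?_, fun k => ?_⟩
    · by_cases h : Even i <;> simp [s, h] <;> omega
    · rcases Int.even_or_odd' k with ⟨i, rfl | rfl⟩
      · have h1 : Even (2 * i) := even_two_mul i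
        have h2 : ¬ Even (2 * i + 1) := Int.not_even_two_mul_add_one i
        have h3 : 2 * i / 2 = i := by omega
        have h4 : (2 * i + 1) / 2 = i := by omega
        simp only [x, s, if_pos h1, if_neg h2, h3, h4]
        rw [dist_comm]
        exact hw1 _ _
      · have h1 : Even (2 * i + 1 + 1) := ⟨i + 1, by ring⟩
        have h2 : ¬ Even (2 * i + 1) := Int.not_even_two_mul_add_one i
        have h3 : (2 * i + 1 + 1) / 2 = i + 1 := by omega
        have h4 : (2 * i + 1) / 2 = i := by omega
        simp only [x, s, if_pos h1, if_neg h2, h3, h4]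
        exact hw2 _ _
  obtain ⟨z, hz⟩ := hshadow x s hpo
  refine ⟨z, fun i j hj => ?_⟩
  have h1 : Even (2 * (i : ℤ)) := even_two_mul _
  have h2 : s (2 * (i : ℤ)) = n := if_pos h1
  have h3 : x (2 * (i : ℤ)) = y i := by
    have h5 : 2 * (i : ℤ) / 2 = i := by omega
    simp only [x, if_pos h1, h5, Y, Int.toNat_natCast]
  have h4 := hz (2 * (i : ℤ)) j (by rwa [h2])
  rw [h2, h3, csum_alternating, ← Nat.cast_add, zpow_natCast, ← Equiv.Perm.iterate_eq_pow] at h4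
  exact h4

end Gluing

section UniformGrowth

variable {X : Type*} {m : ℕ} {f : X → X} {A : X → (Em m ≃L[ℝ] Em m)} {c : ℝ}

lemma norm_cocycle_sub_le (z p : X) (M : ℕ) :
    ‖cocycle f A z M - cocycle f A p M‖ ≤ ∑ j ∈ Finset.range M,
      ‖cocycle f A (f^[j + 1] z) (M - (j + 1))‖ *
        (‖(A (f^[j] z) : Em m →L[ℝ] Em m) - (A (f^[j] p) : Em m →L[ℝ] Em m)‖ *
          ‖cocycle f A p j‖) := by
  let T : ℕ → (Em m →L[ℝ] Em m) := fun j => (cocycle f A (f^[j] z) (M - j)).comp (cocycle f A p j)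
  have hT : cocycle f A z M - cocycle f A p M = ∑ j ∈ Finset.range M, (T j - T (j + 1)) := by
    rw [Finset.sum_range_sub']
    simp only [T, Nat.sub_self, Nat.sub_zero]
    rfl
  rw [hT]
  refine (norm_sum_le _ _).trans (Finset.sum_le_sum fun j hj => ?_)
  have hj' := Finset.mem_range.1 hj
  have h1 : T j - T (j + 1) = (cocycle f A (f^[j + 1] z) (M - (j + 1))).comp
      (((A (f^[j] z) : Em m →L[ℝ] Em m) - (A (f^[j] p) : Em m →L[ℝ] Em m)).comp
        (cocycle f A p j)) := by
    have h2 : M - j = 1 + (M - (j + 1)) := by omega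
    simp only [T]
    rw [h2, cocycle_add, ← Function.iterate_add_apply, add_comm 1 j]
    ext v
    simp [cocycle]
  rw [h1]
  refine (ContinuousLinearMap.opNorm_comp_le _ _).trans ?_
  gcongr
  exact ContinuousLinearMap.opNorm_comp_le _ _

variable [NeZero m]

lemma NormLogBound.norm_cocycle_sub_le_exp (hc : NormLogBound A c) {N : ℕ} (hN : 0 < N)
    {z p : X} {M : ℕ} {η ε : ℝ} (hη : 0 ≤ η) (hε : 0 ≤ ε)
    (h1 : ∀ j < M, ‖(A (f^[j] z) : Em m →L[ℝ] Em m) - (A (f^[j] p) : Em m →L[ℝ] Em m)‖ ≤ η)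
    (h2 : ∀ j < M, |cocycleLog f A N (f^[j] z) / N - cocycleLog f A N (f^[j] p) / N| ≤ ε) :
    ‖cocycle f A z M - cocycle f A p M‖ ≤ M * (η * Real.exp
      (birkhoffSum f (fun y => cocycleLog f A N y / N) M p + M * ε + c + 8 * c * N)) := by
  refine (norm_cocycle_sub_le z p M).trans ?_
  rw [← nsmul_eq_mul]
  conv_rhs => rw [← Finset.card_range M]
  refine Finset.sum_le_card_nsmul _ _ _ fun j hj => ?_
  have hj' := Finset.mem_range.1 hj
  rw [Finset.card_range]
  set φ : X → ℝ := fun y => cocycleLog f A N y / N with hφ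
  have h3 := hc.cocycleLog_le_birkhoffSum (f := f) hN (M - (j + 1)) (f^[j + 1] z)
  have h4 := hc.cocycleLog_le_birkhoffSum (f := f) hN j p
  have h5 : birkhoffSum f φ M p = birkhoffSum f φ j p + φ (f^[j] p)
      + birkhoffSum f φ (M - (j + 1)) (f^[j + 1] p) := by
    have h6 : M = (j + 1) + (M - (j + 1)) := by omega
    conv_lhs => rw [h6]
    rw [birkhoffSum_add, birkhoffSum_succ]
  have h7 : |birkhoffSum f φ (M - (j + 1)) (f^[j + 1] z)
      - birkhoffSum f φ (M - (j + 1)) (f^[j + 1] p)| ≤ ((M - (j + 1) : ℕ) : ℝ) * ε :=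
    abs_birkhoffSum_sub_le fun i hi => by
      rw [← Function.iterate_add_apply, ← Function.iterate_add_apply]
      exact h2 _ (by omega)
  have h8 : ((M - (j + 1) : ℕ) : ℝ) * ε ≤ M * ε := by
    gcongr
    exact Nat.sub_le _ _
  have h9 : |φ (f^[j] p)| ≤ c := hc.abs_cocycleLog_div_le N _
  calc _ ≤ Real.exp (birkhoffSum f φ (M - (j + 1)) (f^[j + 1] z) + 4 * c * N) *
        (η * Real.exp (birkhoffSum f φ j p + 4 * c * N)) := by
        rw [← hc.exp_cocycleLog, ← hc.exp_cocycleLog]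
        gcongr
        exact h1 j hj'
    _ = η * Real.exp (birkhoffSum f φ (M - (j + 1)) (f^[j + 1] z) + 4 * c * N
          + (birkhoffSum f φ j p + 4 * c * N)) := by
        rw [Real.exp_add _ (birkhoffSum f φ j p + 4 * c * N)]; ring
    _ ≤ _ := mul_le_mul_of_nonneg_left
        (Real.exp_le_exp.2 (by linarith [abs_le.1 h7, abs_le.1 h9])) hη

/-- A lower growth bound passes from `p` to a point `x` whose orbit segment is exponentially
close to that of `p` away from its ends. -/
lemma NormLogBound.le_cocycleLog_of_exp_close [MetricSpace X] (hc : NormLogBound A c) {N : ℕ}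
    (hN : 0 < N) {α C lam τ ε K : ℝ} (hα : 0 < α) (hC : 0 ≤ C) (hlam : 0 < lam) (hτ1 : τ ≤ 1)
    (hτ0 : 0 < τ) (hε : 0 ≤ ε)
    (hA : ∀ x y : X, ‖(A x : Em m →L[ℝ] Em m) - (A y : Em m →L[ℝ] Em m)‖ ≤ C * dist x y ^ α)
    (hφ : ∀ x y : X, dist x y < τ → |cocycleLog f A N x / N - cocycleLog f A N y / N| ≤ ε)
    {n a : ℕ} (ha : 2 * a ≤ n) {x p : X}
    (hp : ∀ j < n, dist (f^[j] p) (f^[j] x) < τ * Real.exp (-lam * ((min j (n - j) : ℕ) : ℝ)))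
    (hlow : birkhoffSum f (fun y => cocycleLog f A N y / N) n x - 2 * ε * n - K
      ≤ cocycleLog f A n p)
    (hsmall : n * (C * Real.exp (-(lam * α * a) + 4 * ε * n + c + 16 * c * N + K)) ≤ 1 / 2) :
    birkhoffSum f (fun y => cocycleLog f A N y / N) n x
      - 4 * ε * n - 4 * c * a - K - 8 * c * N - 1 ≤ cocycleLog f A n x := by
  set φ : X → ℝ := fun y => cocycleLog f A N y / N with hφdef
  obtain ⟨M, rfl⟩ : ∃ M, n = a + M + a := ⟨n - 2 * a, by omega⟩
  set n := a + M + a with hn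
  have hMn : (M : ℝ) ≤ n := by exact_mod_cast (by omega : M ≤ n)
  have hexp : ∀ j : ℕ, Real.exp (-lam * (j : ℝ)) ≤ 1 := fun j =>
    Real.exp_le_one_iff.2 (by have := Nat.cast_nonneg (α := ℝ) j; nlinarith)
  have hclose : ∀ j < n, |φ (f^[j] x) - φ (f^[j] p)| ≤ ε := fun j hj => by
    refine hφ _ _ ?_
    rw [dist_comm]
    calc _ < _ := hp j hj
      _ ≤ τ * 1 := by gcongr; exact hexp _
      _ = τ := mul_one τ
  have hSn := abs_le.1 (abs_birkhoffSum_sub_le hclose)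
  have hsplit : birkhoffSum f φ n p = birkhoffSum f φ a p + birkhoffSum f φ M (f^[a] p)
      + birkhoffSum f φ a (f^[a + M] p) := by
    rw [hn, birkhoffSum_add, birkhoffSum_add]
  have hL1 := hc.cocycleLog_add_le (f := f) p (a + M) a
  have hL2 := hc.cocycleLog_add_le (f := f) p a M
  have hL3 := hc.cocycleLog_le_birkhoffSum (f := f) hN a p
  have hL4 := hc.cocycleLog_le_birkhoffSum (f := f) hN a (f^[a + M] p)
  have hmid : birkhoffSum f φ M (f^[a] p) - 3 * ε * n - K - 8 * c * N
      ≤ cocycleLog f A M (f^[a] p) := by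
    linarith
  set η := C * Real.exp (-(lam * α * a)) with hη
  have hη0 : 0 ≤ η := by positivity
  have hAclose : ∀ j < M, ‖(A (f^[j] (f^[a] x)) : Em m →L[ℝ] Em m)
      - (A (f^[j] (f^[a] p)) : Em m →L[ℝ] Em m)‖ ≤ η := by
    intro j hj
    refine (hA _ _).trans ?_
    rw [← Function.iterate_add_apply, ← Function.iterate_add_apply, dist_comm]
    have h1 := hp (j + a) (by omega)
    have h2 : a ≤ min (j + a) (n - (j + a)) := by omega
    have h3 : dist (f^[j + a] p) (f^[j + a] x) ≤ Real.exp (-lam * a) := by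
      refine h1.le.trans ?_
      calc _ ≤ 1 * Real.exp (-lam * a) := by
            gcongr ?_ * Real.exp ?_
            have : (a : ℝ) ≤ ((min (j + a) (n - (j + a)) : ℕ) : ℝ) := by exact_mod_cast h2
            nlinarith
        _ = _ := one_mul _
    calc C * dist (f^[j + a] p) (f^[j + a] x) ^ α ≤ C * Real.exp (-lam * a) ^ α := by gcongr
      _ = η := by rw [hη, ← Real.exp_mul]; ring_nf
  have hsub := hc.norm_cocycle_sub_le_exp (f := f) hN hη0 hε hAclose (fun j hj => by
    rw [← Function.iterate_add_apply, ← Function.iterate_add_apply]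
    exact hclose (j + a) (by omega))
  set Q := birkhoffSum f φ M (f^[a] p) - 3 * ε * n - K - 8 * c * N with hQ
  have hMε : (M : ℝ) * ε ≤ n * ε := by gcongr
  have hsub' : ‖cocycle f A (f^[a] x) M - cocycle f A (f^[a] p) M‖ ≤ 1 / 2 * Real.exp Q := by
    refine hsub.trans ?_
    calc _ ≤ n * (η * Real.exp ((4 * ε * n + c + 16 * c * N + K) + Q)) := by
          refine mul_le_mul hMn (mul_le_mul_of_nonneg_left (Real.exp_le_exp.2 ?_) hη0)
            (by positivity) (by positivity)
          linarith
      _ = n * (C * Real.exp (-(lam * α * a) + 4 * ε * n + c + 16 * c * N + K)) * Real.exp Q := by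
          have h1 : -(lam * α * a) + 4 * ε * n + c + 16 * c * N + K
              = -(lam * α * a) + (4 * ε * n + c + 16 * c * N + K) := by ring
          rw [hη, h1, Real.exp_add _ Q, Real.exp_add (-(lam * α * a))]; ring
      _ ≤ _ := by gcongr
  have hxlow : 1 / 2 * Real.exp Q ≤ ‖cocycle f A (f^[a] x) M‖ := by
    have h1 : Real.exp Q ≤ ‖cocycle f A (f^[a] p) M‖ := by
      rw [← hc.exp_cocycleLog]; exact Real.exp_le_exp.2 hmid
    have h2 := norm_sub_norm_le (cocycle f A (f^[a] p) M) (cocycle f A (f^[a] x) M)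
    rw [norm_sub_rev] at h2
    linarith
  have hxlog : Q - 1 ≤ cocycleLog f A M (f^[a] x) := by
    rw [← Real.exp_le_exp, hc.exp_cocycleLog]
    refine le_trans ?_ hxlow
    rw [sub_eq_add_neg, Real.exp_add, mul_comm]
    gcongr
    rw [Real.exp_neg, one_div]
    refine inv_anti₀ two_pos ?_
    linarith [Real.add_one_le_exp (1 : ℝ)]
  have hL5 := hc.cocycleLog_le_add (f := f) x (a + M) a
  have hL6 := hc.cocycleLog_iterate_le (f := f) x a M
  have hB : ∀ y, |φ y| ≤ c := fun y => hc.abs_cocycleLog_div_le N y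
  have h1 := abs_le.1 (abs_birkhoffSum_le (f := f) hB a p)
  have h2 := abs_le.1 (abs_birkhoffSum_le (f := f) hB a (f^[a + M] p))
  linarith

lemma NormLogBound.cocycleLog_mul_le (hc : NormLogBound A c) {B : ℕ} {R : ℝ} {w : X}
    (h : ∀ i : ℕ, cocycleLog f A B (f^[i * B] w) ≤ R) (l i : ℕ) :
    cocycleLog f A (l * B) (f^[i * B] w) ≤ l * R := by
  induction l with
  | zero => simp [cocycleLog, cocycle, ContinuousLinearMap.norm_id]
  | succ l ih =>
    have h1 := hc.cocycleLog_add_le (f := f) (f^[i * B] w) (l * B) B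
    rw [← Function.iterate_add_apply, ← Nat.add_mul] at h1
    rw [Nat.succ_mul]
    push_cast
    linarith [h (l + i)]

lemma le_birkhoffSum_mul {φ : X → ℝ} {B : ℕ} {R : ℝ} {w : X}
    (h : ∀ i : ℕ, R ≤ birkhoffSum f φ B (f^[i * B] w)) (k : ℕ) :
    k * R ≤ birkhoffSum f φ (k * B) w := by
  induction k with
  | zero => simp
  | succ k ih =>
    rw [Nat.succ_mul, birkhoffSum_add]
    push_cast
    linarith [h k]

section Closing

variable [MetricSpace X] [CompactSpace X] [MeasurableSpace X] [BorelSpace X]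

/-- Along an orbit whose averages converge to `μ`, some block of length `B` grows at least at
the rate of `μ`. -/
lemma NormLogBound.exists_block_le_cocycleLog (hc : NormLogBound A c) (hf : Continuous f)
    (hA : Continuous fun x => (A x : Em m →L[ℝ] Em m)) {B : ℕ} (hB : 0 < B) {w : X}
    {μ : ProbabilityMeasure X} {U : Ultrafilter ℕ} (hU : (U : Filter ℕ) ≤ atTop)
    (hlim : ∀ φ : X → ℝ, Continuous φ → Tendsto
      (fun k => birkhoffSum f φ (k * B) w / ((k * B : ℕ) : ℝ)) U
      (𝓝 (∫ x, φ x ∂(μ : Measure X)))) :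
    ∃ i : ℕ, B * mle f A (μ : Measure X) - 1 ≤ cocycleLog f A B (f^[i * B] w) := by
  by_contra! hcon
  set R := B * mle f A (μ : Measure X) - 1 with hR
  have hB' : (0 : ℝ) < B := by exact_mod_cast hB
  have hc0 := hc.1
  have h1 : ∀ l s : ℕ, cocycleLog f A (l * B) (f^[s] w) ≤ l * R + 2 * c * B := by
    intro l s
    set r := s % B
    set i := s / B
    have hs : s = r + i * B := by rw [mul_comm i]; exact (Nat.mod_add_div s B).symm
    have hr : (r : ℝ) ≤ B := by exact_mod_cast (Nat.mod_lt s hB).le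
    have h2 := hc.cocycleLog_mul_le (fun i => (hcon i).le) l i
    have h3 := hc.cocycleLog_iterate_le (f := f) (f^[i * B] w) r (l * B)
    have h4 := hc.cocycleLog_add_le (f := f) (f^[i * B] w) (l * B) r
    have h5 := (abs_le.1 (hc.abs_cocycleLog_le (f := f) r (f^[l * B] (f^[i * B] w)))).2
    rw [← Function.iterate_add_apply, ← hs, add_comm r] at h3
    have : c * r ≤ c * B := by gcongr
    linarith
  have h2 : ∀ l : ℕ, 0 < l → (l : ℝ) ≤ 2 * c * B := by
    intro l hl
    have hcont := hc.continuous_cocycleLog hf hA (l * B)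
    have h3 : ∫ x, cocycleLog f A (l * B) x ∂(μ : Measure X) ≤ l * R + 2 * c * B := by
      refine le_of_tendsto (hlim _ hcont) ?_
      filter_upwards [(eventually_gt_atTop 0).filter_mono hU] with k hk
      have hkB : (0 : ℝ) < ((k * B : ℕ) : ℝ) := by exact_mod_cast Nat.mul_pos hk hB
      rw [div_le_iff₀ hkB, birkhoffSum]
      refine (Finset.sum_le_sum fun s _ => h1 l s).trans_eq ?_
      rw [Finset.sum_const, Finset.card_range, nsmul_eq_mul, mul_comm]
    have h4 := hc.mle_le hf hA (μ : Measure X) (Nat.mul_pos hl hB)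
    have hlB : (0 : ℝ) < ((l * B : ℕ) : ℝ) := by exact_mod_cast Nat.mul_pos hl hB
    rw [le_div_iff₀ hlB] at h4
    push_cast at h4
    have h5 : (l : ℝ) * R = mle f A (μ : Measure X) * (l * B) - l := by rw [hR]; ring
    linarith
  obtain ⟨l, hl⟩ := exists_nat_gt (2 * c * B)
  have hl0 : 0 < l := by
    have : (0 : ℝ) < l := lt_of_le_of_lt (by positivity) hl
    exact_mod_cast this
  linarith [h2 l hl0]

end Closing

end UniformGrowth

section AsymptoticAdditivity

variable {X : Type*} [MetricSpace X] [CompactSpace X] [MeasurableSpace X] [BorelSpace X]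
  {m : ℕ} [NeZero m] {f : X ≃ₜ X} {A : X → (Em m ≃L[ℝ] Em m)} {c : ℝ}

lemma NormLogBound.exists_close_le_cocycleLog (hc : NormLogBound A c)
    (hA : Continuous fun x => (A x : Em m →L[ℝ] Em m)) {lam τ ε : ℝ} {N Ng n : ℕ}
    (hlam : 0 < lam) (hτ : 0 < τ) (hn : 0 < n)
    (hglue : ∀ y : ℕ → X, ∃ z : X, ∀ i j : ℕ, j < n →
      dist ((⇑f)^[i * (n + Ng) + j] z) ((⇑f)^[j] (y i))
        < τ * Real.exp (-lam * ((min j (n - j) : ℕ) : ℝ)))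
    (hφ : ∀ x y : X, dist x y < τ → |cocycleLog f A N x / N - cocycleLog f A N y / N| ≤ ε)
    (hmle : ∀ μ : ProbabilityMeasure X, MeasurePreserving f (μ : Measure X) (μ : Measure X) →
      (∫ x, cocycleLog f A N x ∂(μ : Measure X)) / N ≤ mle f A (μ : Measure X) + ε)
    (x : X) :
    ∃ p : X, (∀ j < n, dist ((⇑f)^[j] p) ((⇑f)^[j] x)
        < τ * Real.exp (-lam * ((min j (n - j) : ℕ) : ℝ))) ∧
      birkhoffSum f (fun y => cocycleLog f A N y / N) n x - 2 * ε * n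
        - (2 * c * Ng + ε * Ng + 1) ≤ cocycleLog f A n p := by
  obtain ⟨w, hw⟩ := hglue fun _ => x
  set φ : X → ℝ := fun y => cocycleLog f A N y / N with hφdef
  set B := n + Ng with hBdef
  have hB : 0 < B := by omega
  have hB' : (0 : ℝ) < B := by exact_mod_cast hB
  have hφc : Continuous φ := (hc.continuous_cocycleLog f.continuous hA N).div_const _
  obtain ⟨μ, U, hU, hμ, hlim⟩ := exists_invariant_tendsto_birkhoffSum f.continuous w
    (T := fun k => k * B) (tendsto_id.atTop_mul_const' hB)
  have hclose : ∀ i : ℕ, ∀ j < n, dist ((⇑f)^[j] ((⇑f)^[i * B] w)) ((⇑f)^[j] x)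
      < τ * Real.exp (-lam * ((min j (n - j) : ℕ) : ℝ)) := fun i j hj => by
    rw [← Function.iterate_add_apply, add_comm j]
    exact hw i j hj
  have hexp : ∀ j : ℕ, Real.exp (-lam * (j : ℝ)) ≤ 1 := fun j =>
    Real.exp_le_one_iff.2 (by have := Nat.cast_nonneg (α := ℝ) j; nlinarith)
  have hblock : ∀ i : ℕ, birkhoffSum f φ n x - n * ε - c * Ng
      ≤ birkhoffSum f φ B ((⇑f)^[i * B] w) := by
    intro i
    rw [hBdef, birkhoffSum_add]
    have h1 := abs_le.1 (abs_birkhoffSum_le (f := ⇑f) (φ := φ)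
      (fun y => hc.abs_cocycleLog_div_le N y) Ng ((⇑f)^[n] ((⇑f)^[i * B] w)))
    have h2 := abs_le.1 (abs_birkhoffSum_sub_le (f := ⇑f) (φ := φ) (ε := ε) (n := n)
      (x := (⇑f)^[i * B] w) (y := x) fun j hj => hφ _ _ ?_)
    · linarith
    · calc _ < _ := hclose i j hj
        _ ≤ τ * 1 := by gcongr; exact hexp _
        _ = τ := mul_one τ
  have hφμ : (birkhoffSum f φ n x - n * ε - c * Ng) / B ≤ ∫ x, φ x ∂(μ : Measure X) := by
    refine ge_of_tendsto (hlim φ hφc) ?_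
    filter_upwards [(eventually_gt_atTop 0).filter_mono hU] with k hk
    have hk' : (0 : ℝ) < k := by exact_mod_cast hk
    have h1 := le_birkhoffSum_mul hblock k
    push_cast
    rw [div_le_div_iff₀ hB' (by positivity)]
    nlinarith
  obtain ⟨i, hi⟩ := hc.exists_block_le_cocycleLog f.continuous hA hB hU hlim
  refine ⟨(⇑f)^[i * B] w, hclose i, ?_⟩
  have h1 := hmle μ hμ
  rw [← integral_div] at h1
  have h2 : birkhoffSum f φ n x - n * ε - c * Ng ≤ B * (mle f A (μ : Measure X) + ε) := by
    rw [div_le_iff₀ hB'] at hφμ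
    refine hφμ.trans ?_
    rw [mul_comm]
    gcongr
  have h3 := hc.cocycleLog_add_le (f := ⇑f) ((⇑f)^[i * B] w) n Ng
  have h4 := (abs_le.1 (hc.abs_cocycleLog_le (f := ⇑f) Ng ((⇑f)^[n] ((⇑f)^[i * B] w)))).2
  rw [← hBdef] at h3
  have h5 : (B : ℝ) = n + Ng := by rw [hBdef]; push_cast; rfl
  rw [mul_add, h5] at h2
  rw [h5] at hi
  linarith

/-- Up to a uniformly small linear error, `log ‖A(x,n)‖` is a Birkhoff sum. -/
theorem NormLogBound.exists_abs_cocycleLog_sub_birkhoffSum_le (hc : NormLogBound A c)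
    (hmix : TopMixingOn (⇑f) univ) (hshadow : ExpShadowing f.toEquiv) (hA : HolderMat A)
    (hlsc : LowerSemicontinuousOn (fun μ : ProbabilityMeasure X => mle (⇑f) A (μ : Measure X))
      {μ : ProbabilityMeasure X | MeasurePreserving (⇑f) (μ : Measure X) (μ : Measure X)})
    {ε' : ℝ} (hε' : 0 < ε') :
    ∃ N : ℕ, 0 < N ∧
      (∀ μ : ProbabilityMeasure X, MeasurePreserving f (μ : Measure X) (μ : Measure X) →
        (∫ x, cocycleLog f A N x ∂(μ : Measure X)) / N ≤ mle f A (μ : Measure X) + ε') ∧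
      ∀ᶠ n : ℕ in atTop, ∀ x : X,
        |cocycleLog f A n x - birkhoffSum f (fun y => cocycleLog f A N y / N) n x| ≤ ε' * n := by
  have hAc := hA.continuous
  obtain ⟨α, C, hα, hC, hAh⟩ := hA
  obtain ⟨lam, hlam, hsh⟩ := hshadow
  have hc0 := hc.1
  set κ := min (1 / 4) (ε' / (16 * (c + 1))) with hκ
  have hκ0 : 0 < κ := by positivity
  have hκ1 : κ ≤ 1 / 4 := min_le_left _ _
  have hκ2 : 4 * c * κ ≤ ε' / 4 := by
    have h1 : κ ≤ ε' / (16 * (c + 1)) := min_le_right _ _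
    rw [le_div_iff₀ (by positivity)] at h1
    nlinarith
  set ε := min (ε' / 16) (lam * α * κ / 5) with hε
  have hε0 : 0 < ε := by positivity
  have hε1 : 4 * ε ≤ ε' / 4 := by linarith [min_le_left (ε' / 16) (lam * α * κ / 5)]
  have hε2 : 5 * ε ≤ lam * α * κ := by linarith [min_le_right (ε' / 16) (lam * α * κ / 5)]
  obtain ⟨N, hN, hmle⟩ := hc.exists_integral_cocycleLog_le f.continuous hAc hlsc hε0
  have hφc : Continuous fun y => cocycleLog f A N y / N :=
    (hc.continuous_cocycleLog f.continuous hAc N).div_const _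
  obtain ⟨τ₀, hτ₀, hunif⟩ := Metric.uniformContinuous_iff.1
    (CompactSpace.uniformContinuous_of_continuous hφc) ε hε0
  set τ := min 1 τ₀ with hτ
  have hτ0 : 0 < τ := by positivity
  have hφ : ∀ x y : X, dist x y < τ →
      |cocycleLog f A N x / N - cocycleLog f A N y / N| ≤ ε := fun x y hxy =>
    (hunif (lt_of_lt_of_le hxy (min_le_right _ _))).le
  obtain ⟨Ng, hNg, hglue⟩ := exists_glued_orbit hmix hsh hτ0
  set K := 2 * c * Ng + ε * Ng + 1 with hK
  have hlin : ∀ D : ℝ, ∀ r > 0, ∀ᶠ n : ℕ in atTop, D ≤ r * n := fun D r hr =>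
    (tendsto_natCast_atTop_atTop.const_mul_atTop hr).eventually_ge_atTop D
  have hsmall : ∀ᶠ n : ℕ in atTop,
      n * (C * Real.exp (-(ε * n) + c + 16 * c * N + K)) ≤ 1 / 2 := by
    have h1 : Tendsto (fun n : ℕ => C * Real.exp (c + 16 * c * N + K) *
        ((n : ℝ) ^ 1 * Real.exp (-ε * n))) atTop
        (𝓝 (C * Real.exp (c + 16 * c * N + K) * 0)) := by
      refine Tendsto.const_mul _ ?_
      have h2 := (tendsto_rpow_mul_exp_neg_mul_atTop_nhds_zero 1 ε hε0).comp
        (tendsto_natCast_atTop_atTop (R := ℝ))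
      simpa [Function.comp_def] using h2
    rw [mul_zero] at h1
    filter_upwards [h1.eventually_le_const (by norm_num : (0 : ℝ) < 1 / 2)] with n hn
    refine le_of_eq_of_le ?_ hn
    have h3 : -(ε * n) + c + 16 * c * N + K = (c + 16 * c * N + K) + -ε * n := by ring
    rw [h3, Real.exp_add]
    ring
  refine ⟨N, hN, fun μ hμ => (hmle μ hμ).trans (by linarith), ?_⟩
  filter_upwards [hlin (4 * c * N) ε' hε',
    hlin (4 * c + K + 8 * c * N + 1) (ε' / 2) (by positivity),
    hsmall, eventually_ge_atTop 4] with n hn1 hn2 hn3 hn4 x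
  have hn4' : (4 : ℝ) ≤ n := by exact_mod_cast hn4
  rw [abs_le]
  refine ⟨?_, by linarith [hc.cocycleLog_le_birkhoffSum (f := ⇑f) hN n x]⟩
  obtain ⟨p, hp1, hp2⟩ := hc.exists_close_le_cocycleLog hAc hlam hτ0 (by omega)
    (hglue n (by omega)) hφ hmle x
  set a := ⌈κ * n⌉₊ with ha
  have ha1 : κ * n ≤ a := Nat.le_ceil _
  have ha2 : (a : ℝ) < κ * n + 1 := Nat.ceil_lt_add_one (by positivity)
  have ha3 : 2 * a ≤ n := by
    have h1 : κ * n ≤ 1 / 4 * n := by gcongr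
    have : (2 * a : ℝ) ≤ n := by linarith
    exact_mod_cast this
  have h1 := hc.le_cocycleLog_of_exp_close hN hα hC hlam (min_le_left _ _) hτ0 hε0.le hAh hφ ha3
    hp1 hp2 ?_
  · have h2 : 4 * c * a ≤ 4 * c * (κ * n + 1) := by gcongr
    have h3 : 4 * c * κ * n ≤ ε' / 4 * n := by gcongr
    have h4 : 4 * ε * n ≤ ε' / 4 * n := by gcongr
    linarith
  · refine le_trans ?_ hn3
    gcongr
    have h2 : lam * α * (κ * n) ≤ lam * α * a := by gcongr
    have h3 : 5 * ε * n ≤ lam * α * κ * n := by gcongr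
    linarith

end AsymptoticAdditivity

section OscillatingSet

lemma count_even_log_four_le {l : ℕ} (hl : 0 < l) :
    4 * Nat.count (fun a => Even (Nat.log 4 a)) (4 ^ (2 * l)) ≤ 4 ^ (2 * l) := by
  obtain ⟨r, hr⟩ : ∃ r, 2 * l = r + 1 := ⟨2 * l - 1, by omega⟩
  have hodd : ¬ Even r := by
    rw [Nat.not_even_iff_odd]
    exact ⟨l - 1, by omega⟩
  have h1 : 4 ^ (2 * l) = 4 ^ r + 3 * 4 ^ r := by rw [hr, pow_succ]; ring
  have h2 : Nat.count (fun k => Even (Nat.log 4 (4 ^ r + k))) (3 * 4 ^ r) = 0 := by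
    rw [Nat.count_iff_forall_not]
    intro k hk
    rwa [Nat.log_eq_of_pow_le_of_lt_pow (m := r) (by omega) (by rw [pow_succ]; omega)]
  rw [h1, Nat.count_add, h2]
  have := Nat.count_le (p := fun a => Even (Nat.log 4 a)) (n := 4 ^ r)
  omega

lemma le_count_even_log_four (l : ℕ) :
    3 * 4 ^ (2 * l + 1) ≤ 4 * Nat.count (fun a => Even (Nat.log 4 a)) (4 ^ (2 * l + 1)) := by
  have h1 : 4 ^ (2 * l + 1) = 4 ^ (2 * l) + 3 * 4 ^ (2 * l) := by rw [pow_succ]; ring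
  have h2 : Nat.count (fun k => Even (Nat.log 4 (4 ^ (2 * l) + k))) (3 * 4 ^ (2 * l))
      = 3 * 4 ^ (2 * l) := by
    rw [Nat.count_iff_forall]
    intro k hk
    rw [Nat.log_eq_of_pow_le_of_lt_pow (m := 2 * l) (by omega) (by rw [pow_succ]; omega)]
    exact even_two_mul l
  rw [h1, Nat.count_add, h2]
  omega

lemma count_dvd_and_mul {q : ℕ} (hq : 0 < q) (p : ℕ → Prop) [DecidablePred p] (M : ℕ) :
    Nat.count (fun i => q ∣ i ∧ p (i / q)) (q * M) = Nat.count p M := by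
  induction M with
  | zero => simp
  | succ M ih =>
    obtain ⟨r, rfl⟩ : ∃ r, q = 1 + r := ⟨q - 1, by omega⟩
    have h1 : Nat.count (fun k => (1 + r) ∣ ((1 + r) * M + (1 + k)) ∧
        p (((1 + r) * M + (1 + k)) / (1 + r))) r = 0 := by
      rw [Nat.count_iff_forall_not]
      rintro k hk ⟨h2, -⟩
      have h3 := (Nat.dvd_add_right (dvd_mul_right (1 + r) M)).1 h2
      exact absurd (Nat.le_of_dvd (by omega) h3) (by omega)
    rw [Nat.mul_add_one, Nat.count_add, ih, Nat.count_add, h1, Nat.count_succ p M]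
    simp [Nat.count_succ]

/-- A set of density at most `1 / q` whose density oscillates. -/
lemma exists_oscillating_set {q : ℕ} (hq : 0 < q) :
    ∃ (p : ℕ → Prop) (_ : DecidablePred p), (∀ k, q * Nat.count p k ≤ k + q) ∧
      (∀ k₀, ∃ k ≥ k₀, 4 * q * Nat.count p k ≤ k) ∧
      ∀ k₀, ∃ k ≥ k₀, 3 * k ≤ 4 * q * Nat.count p k := by
  have hgrow : ∀ l : ℕ, l ≤ 4 ^ (2 * l) := fun l =>
    (show l ≤ 2 * l by omega).trans (Nat.lt_pow_self (by norm_num)).le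
  refine ⟨fun i => q ∣ i ∧ Even (Nat.log 4 (i / q)), inferInstance, fun k => ?_, fun k₀ => ?_,
    fun k₀ => ?_⟩
  · have h1 : k ≤ q * (k / q + 1) := (Nat.lt_mul_div_succ k hq).le
    have h2 := Nat.count_monotone (fun i => q ∣ i ∧ Even (Nat.log 4 (i / q))) h1
    rw [count_dvd_and_mul hq (fun a => Even (Nat.log 4 a))] at h2
    have h3 := h2.trans (Nat.count_le _)
    calc _ ≤ q * (k / q + 1) := by gcongr
      _ ≤ k + q := by rw [mul_add, mul_one]; gcongr; exact Nat.mul_div_le k q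
  · refine ⟨q * 4 ^ (2 * (k₀ + 1)), ?_, ?_⟩
    · have := hgrow (k₀ + 1)
      exact ((Nat.le_succ _).trans this).trans (Nat.le_mul_of_pos_left _ hq)
    · rw [count_dvd_and_mul hq (fun a => Even (Nat.log 4 a))]
      have := count_even_log_four_le (Nat.succ_pos k₀)
      calc _ = q * (4 * Nat.count (fun a => Even (Nat.log 4 a)) (4 ^ (2 * (k₀ + 1)))) := by ring
        _ ≤ _ := by gcongr
  · refine ⟨q * 4 ^ (2 * k₀ + 1), ?_, ?_⟩
    · have h1 := hgrow k₀
      have h2 : 4 ^ (2 * k₀) ≤ 4 ^ (2 * k₀ + 1) := Nat.pow_le_pow_right (by norm_num) (by omega)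
      exact (h1.trans h2).trans (Nat.le_mul_of_pos_left _ hq)
    · rw [count_dvd_and_mul hq (fun a => Even (Nat.log 4 a))]
      have := le_count_even_log_four k₀
      calc _ = q * (3 * 4 ^ (2 * k₀ + 1)) := by ring
        _ ≤ q * (4 * Nat.count (fun a => Even (Nat.log 4 a)) (4 ^ (2 * k₀ + 1))) := by gcongr
        _ = _ := by ring

lemma not_tendsto_div_of_oscillating {q B : ℕ} (hq : 0 < q) (hB : 0 < B) {p : ℕ → Prop}
    [DecidablePred p] (h1 : ∀ k₀, ∃ k ≥ k₀, 4 * q * Nat.count p k ≤ k)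
    (h2 : ∀ k₀, ∃ k ≥ k₀, 3 * k ≤ 4 * q * Nat.count p k) {L : ℕ → ℝ} {a w e : ℝ}
    (hL : ∀ᶠ k : ℕ in atTop, |L (k * B) - (k * a + Nat.count p k * w)| ≤ k * e)
    (hw : 4 * q * e < |w|) (l : ℝ) : ¬ Tendsto (fun n : ℕ => L n / n) atTop (𝓝 l) := by
  intro hl
  have hq' : (0 : ℝ) < q := by exact_mod_cast hq
  have hB' : (0 : ℝ) < B := by exact_mod_cast hB
  obtain ⟨η, hη, hηw⟩ : ∃ η > 0, 4 * q * (e + B * η) < |w| := by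
    refine ⟨(|w| - 4 * q * e) / (8 * q * B), div_pos (by linarith) (by positivity), ?_⟩
    have : 4 * q * (e + B * ((|w| - 4 * q * e) / (8 * q * B)))
        = 4 * q * e + (|w| - 4 * q * e) / 2 := by field_simp; ring
    linarith
  have h3 := hl.comp (tendsto_id.atTop_mul_const' hB)
  obtain ⟨k₀, hk₀⟩ := eventually_atTop.1
    ((hL.and (Metric.tendsto_nhds.1 h3 η hη)).and (eventually_gt_atTop 0))
  have key : ∀ k ≥ k₀, 0 < (k : ℝ) ∧
      |a + Nat.count p k / k * w - B * l| ≤ e + B * η := by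
    intro k hk
    obtain ⟨⟨h4, h5⟩, h6⟩ := hk₀ k hk
    have h6' : (0 : ℝ) < k := by exact_mod_cast h6
    refine ⟨h6', ?_⟩
    simp only [Function.comp_apply, id, Real.dist_eq] at h5
    push_cast at h5
    have h7 : |L (k * B) / k - (a + Nat.count p k / k * w)| ≤ e := by
      have : L (k * B) / k - (a + Nat.count p k / k * w)
          = (L (k * B) - (k * a + Nat.count p k * w)) / k := by field_simp
      rw [this, abs_div, abs_of_pos h6', div_le_iff₀ h6']
      linarith
    have h8 : |L (k * B) / k - B * l| ≤ B * η := by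
      have : L (k * B) / k - B * l = B * (L (k * B) / (k * B) - l) := by field_simp
      rw [this, abs_mul, abs_of_pos hB']
      gcongr
    rw [abs_le] at *
    constructor <;> linarith
  obtain ⟨k₁, hk₁, h4⟩ := h1 k₀
  obtain ⟨k₂, hk₂, h5⟩ := h2 k₀
  obtain ⟨h6, h7⟩ := key k₁ hk₁
  obtain ⟨h8, h9⟩ := key k₂ hk₂
  have h10 : (Nat.count p k₁ : ℝ) / k₁ ≤ 1 / (4 * q) := by
    rw [div_le_div_iff₀ h6 (by positivity)]
    have : (4 * q * Nat.count p k₁ : ℝ) ≤ k₁ := by exact_mod_cast h4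
    linarith
  have h11 : 3 / (4 * q) ≤ (Nat.count p k₂ : ℝ) / k₂ := by
    rw [div_le_div_iff₀ (by positivity) h8]
    have : (3 * k₂ : ℝ) ≤ 4 * q * Nat.count p k₂ := by exact_mod_cast h5
    linarith
  have h12 : (2 / (4 * q)) * |w| ≤ 2 * (e + B * η) := by
    calc _ ≤ |(Nat.count p k₂ : ℝ) / k₂ - Nat.count p k₁ / k₁| * |w| := by
          gcongr
          refine le_trans ?_ (le_abs_self _)
          have : (2 : ℝ) / (4 * q) = 3 / (4 * q) - 1 / (4 * q) := by ring
          linarith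
      _ = |(a + Nat.count p k₂ / k₂ * w - B * l) - (a + Nat.count p k₁ / k₁ * w - B * l)| := by
          rw [← abs_mul]; congr 1; ring
      _ ≤ _ := by
          refine (abs_sub _ _).trans ?_
          linarith
  have h13 : (2 / (4 * q)) * |w| * (2 * q) = |w| := by field_simp; ring
  have h14 : (2 / (4 * q)) * |w| * (2 * q) ≤ 2 * (e + B * η) * (2 * q) := by gcongr
  linarith

end OscillatingSet

section CantorEntropy

variable {X : Type*} [MetricSpace X]

/-- Distribution principle: a family of points coded by `ℕ → S`, such that Bowen balls determine
the free coordinates, has Bowen entropy at least the exponential rate of free codes. -/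
lemma le_bowenEntAt_of_coding {f : X → X} {S : Type*} [Fintype S] [Nonempty S] {K : Set X}
    {z : (ℕ → S) → X} (hz : ∀ ω, z ω ∈ K) {p : ℕ → Prop} [DecidablePred p] {q B : ℕ}
    (hq : 0 < q) (hB : 0 < B) (hp : ∀ k, q * Nat.count p k ≤ k + q) {σ : ℝ}
    (hsep : ∀ x u ω ω', z ω ∈ dynBall f x u σ → z ω' ∈ dynBall f x u σ →
      ∀ i, (i + 1) * B ≤ u → ¬ p i → ω i = ω' i) {t : ℝ}
    (ht : t * B ≤ (1 - 1 / q) * Real.log (Fintype.card S)) :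
    (t : EReal) ≤ bowenEntAt f K σ := by
  have hq' : (0 : ℝ) < q := by exact_mod_cast hq
  have hB' : (0 : ℝ) < B := by exact_mod_cast hB
  set s := Real.log (Fintype.card S) with hs
  have hcard : (0 : ℝ) < Fintype.card S := by exact_mod_cast Fintype.card_pos
  have hs0 : 0 ≤ s := Real.log_natCast_nonneg _
  have hexps : Real.exp s = Fintype.card S := Real.exp_log hcard
  let _ : MeasurableSpace S := ⊤
  set ν : Measure S := (PMF.uniformOfFintype S).toMeasure with hν
  set P : Measure (ℕ → S) := Measure.infinitePi fun _ => ν with hP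
  have hball : ∀ (x : X) (u : ℕ), P {ω | z ω ∈ dynBall f x u σ}
      ≤ ENNReal.ofReal (Real.exp (2 * s) * Real.exp (-t * u)) := by
    intro x u
    rcases Set.eq_empty_or_nonempty {ω | z ω ∈ dynBall f x u σ} with h | ⟨ω₀, h₀⟩
    · rw [h, measure_empty]; exact zero_le
    set I : Finset ℕ := {i ∈ Finset.range (u / B) | ¬ p i} with hI
    have hsub : {ω | z ω ∈ dynBall f x u σ} ⊆ Set.pi (I : Set ℕ) fun i => {ω₀ i} := by
      intro ω hω i hi
      have hi' := Finset.mem_filter.1 (Finset.mem_coe.1 hi)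
      refine hsep x u ω ω₀ hω h₀ i ?_ hi'.2
      calc (i + 1) * B ≤ (u / B) * B := by gcongr; exact Finset.mem_range.1 hi'.1
        _ ≤ u := Nat.div_mul_le_self u B
    refine (measure_mono hsub).trans ?_
    rw [hP, Measure.infinitePi_pi _ (fun i _ => MeasurableSet.of_discrete)]
    have hν1 : ∀ a : S, ν {a} = ENNReal.ofReal (Real.exp (-s)) := by
      intro a
      rw [hν, PMF.toMeasure_apply_singleton _ _ (MeasurableSet.of_discrete),
        PMF.uniformOfFintype_apply, Real.exp_neg, hexps, ENNReal.ofReal_inv_of_pos hcard,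
        ENNReal.ofReal_natCast]
    simp only [hν1, Finset.prod_const]
    rw [← ENNReal.ofReal_pow (Real.exp_pos _).le, ← Real.exp_nat_mul, ← Real.exp_add]
    refine ENNReal.ofReal_le_ofReal (Real.exp_le_exp.2 ?_)
    have hIcard : I.card + Nat.count p (u / B) = u / B := by
      rw [Nat.count_eq_card_filter_range, add_comm, hI, Finset.card_filter_add_card_filter_not,
        Finset.card_range]
    set k := u / B with hk
    have hIc : (I.card : ℝ) + Nat.count p k = k := by exact_mod_cast hIcard
    have hpk : (q : ℝ) * Nat.count p k ≤ k + q := by exact_mod_cast hp k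
    have hku : (u : ℝ) ≤ (k + 1) * B := by
      have : u ≤ (k + 1) * B := by rw [mul_comm]; exact (Nat.lt_mul_div_succ u hB).le
      exact_mod_cast this
    have hcnt : (Nat.count p k : ℝ) ≤ 1 / q * k + 1 := by
      rw [← mul_le_mul_iff_right₀ hq']
      refine hpk.trans_eq ?_
      field_simp
    have h1q : (0 : ℝ) ≤ 1 - 1 / q := by
      rw [sub_nonneg, div_le_one hq']
      exact_mod_cast hq
    have h1 : t * u ≤ (1 - 1 / q) * s * (k + 1) := by
      have hu : (0 : ℝ) ≤ u / B := by positivity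
      have h2 : u / B ≤ (k : ℝ) + 1 := by rw [div_le_iff₀ hB']; exact hku
      calc t * u = t * B * (u / B) := by field_simp
        _ ≤ (1 - 1 / q) * s * (u / B) := by gcongr
        _ ≤ _ := by gcongr
    have h2 : s * Nat.count p k ≤ s * (1 / q * k + 1) := by gcongr
    have h3 : (1 - 1 / q) * s ≤ 1 * s := by
      gcongr
      have : (0 : ℝ) ≤ 1 / q := by positivity
      linarith
    have h4 : (I.card : ℝ) = k - Nat.count p k := by linarith
    rw [h4]
    linarith
  refine le_sInf ?_
  rintro _ ⟨t', rfl, ht'⟩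
  by_contra hlt
  have hlt' : t' ≤ t := by
    have := not_le.1 hlt
    exact (EReal.coe_lt_coe_iff.1 this).le
  have hpos : ENNReal.ofReal (Real.exp (-(2 * s))) ≤ bowenCn f K t' σ 0 := by
    refine le_iInf fun D => le_iInf fun hD => le_iInf fun _ => le_iInf fun hcov => ?_
    have : Countable D := hD.to_subtype
    have h1 : (1 : ℝ≥0∞) ≤ ENNReal.ofReal (Real.exp (2 * s)) * bowenSum t' D := by
      calc (1 : ℝ≥0∞) = P univ := measure_univ.symm
        _ ≤ P (⋃ d : D, {ω | z ω ∈ dynBall f d.1.1 d.1.2 σ}) := by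
            refine measure_mono fun ω _ => ?_
            obtain ⟨d, hd, hmem⟩ := mem_iUnion₂.1 (hcov (hz ω))
            exact mem_iUnion.2 ⟨⟨d, hd⟩, hmem⟩
        _ ≤ ∑' d : D, P {ω | z ω ∈ dynBall f d.1.1 d.1.2 σ} := measure_iUnion_le _
        _ ≤ ∑' d : D, ENNReal.ofReal (Real.exp (2 * s)) *
              ENNReal.ofReal (Real.exp (-t' * ((d : X × ℕ).2 : ℝ))) := by
            refine ENNReal.tsum_le_tsum fun d => (hball _ _).trans ?_
            rw [← ENNReal.ofReal_mul (Real.exp_pos _).le]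
            gcongr
        _ = _ := ENNReal.tsum_mul_left
    calc _ = ENNReal.ofReal (Real.exp (-(2 * s))) * 1 := (mul_one _).symm
      _ ≤ ENNReal.ofReal (Real.exp (-(2 * s))) *
          (ENNReal.ofReal (Real.exp (2 * s)) * bowenSum t' D) := by gcongr
      _ = _ := by
          rw [← mul_assoc, ← ENNReal.ofReal_mul (Real.exp_pos _).le, ← Real.exp_add]
          simp
  have h0 : bowenCn f K t' σ 0 = 0 := by
    refine le_antisymm ?_ zero_le
    rw [← ht']
    exact le_iSup (fun n => bowenCn f K t' σ n) 0
  rw [h0, nonpos_iff_eq_zero, ENNReal.ofReal_eq_zero] at hpos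
  exact absurd hpos (not_le.2 (Real.exp_pos _))

end CantorEntropy

section GluedSet

variable {X : Type*} [MetricSpace X] {f : X → X}

/-- The points which `τ`-shadow, in consecutive time windows of length `B`, the first `n` iterates
of points chosen from `S`, except that the windows satisfying `p` use the point `x`. -/
def gluedSet (f : X → X) (S : Finset X) (x : X) (p : ℕ → Prop) [DecidablePred p] (n B : ℕ)
    (τ : ℝ) : Set X :=
  {z | ∃ ω : ℕ → S, ∀ i, ∀ j < n,
    dist (f^[i * B + j] z) (f^[j] (if p i then x else (ω i : X))) ≤ τ}

variable {S : Finset X} {x : X} {p : ℕ → Prop} [DecidablePred p] {n B : ℕ} {τ : ℝ}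

lemma isCompact_gluedSet [CompactSpace X] (hf : Continuous f) :
    IsCompact (gluedSet f S x p n B τ) := by
  have hclosed : IsClosed {w : X × (ℕ → S) | ∀ i, ∀ j < n,
      dist (f^[i * B + j] w.1) (f^[j] (if p i then x else (w.2 i : X))) ≤ τ} := by
    simp only [ofPred_forall]
    refine isClosed_iInter fun i => isClosed_iInter fun j => isClosed_iInter fun _ => ?_
    have h : Continuous fun w : X × (ℕ → S) => if p i then x else (w.2 i : X) := by
      split_ifs
      · exact continuous_const
      · fun_prop
    exact isClosed_le (((hf.iterate _).comp continuous_fst).dist ((hf.iterate j).comp h))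
      continuous_const
  convert hclosed.isCompact.image continuous_fst using 1
  ext z
  simp [gluedSet]

lemma le_bowenEnt_gluedSet (hS : S.Nonempty) {ε₀ : ℝ} (hsep : IsDynSep f univ n ε₀ (S : Set X))
    (hτ : 0 < τ) (hτε : 4 * τ ≤ ε₀) (hnB : n ≤ B) (hB : 0 < B) {q : ℕ} (hq : 0 < q)
    (hp : ∀ k, q * Nat.count p k ≤ k + q)
    (hglue : ∀ y : ℕ → X, ∃ z : X, ∀ i j : ℕ, j < n → dist (f^[i * B + j] z) (f^[j] (y i)) ≤ τ)
    {t : ℝ} (ht : t * B ≤ (1 - 1 / q) * Real.log S.card) :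
    (t : EReal) ≤ bowenEnt f (gluedSet f S x p n B τ) := by
  choose z hz using fun ω : ℕ → S => hglue fun i => if p i then x else (ω i : X)
  have : Nonempty S := hS.to_subtype
  refine le_trans ?_ (le_iSup₂_of_le τ hτ le_rfl)
  have hmem : ∀ ω, z ω ∈ gluedSet f S x p n B τ := fun ω => ⟨ω, hz ω⟩
  refine le_bowenEntAt_of_coding hmem hq hB hp (fun y u ω ω' h h' i hi hpi => ?_)
    (by rwa [Fintype.card_coe])
  by_contra hne
  obtain ⟨j, hj, hlt⟩ := hsep.2 _ (ω i).2 _ (ω' i).2 fun h => hne (Subtype.ext h)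
  have h1 := hz ω i j hj
  have h2 := hz ω' i j hj
  rw [if_neg hpi] at h1 h2
  have hu : i * B + j < u := by
    have : i * B + B ≤ u := by rwa [← Nat.succ_mul]
    omega
  have h3 := h _ hu
  have h4 := h' _ hu
  have h5 := dist_triangle4 (f^[j] (ω i : X)) (f^[i * B + j] (z ω)) (f^[i * B + j] (z ω'))
    (f^[j] (ω' i : X))
  have h6 := dist_triangle_left (f^[i * B + j] (z ω)) (f^[i * B + j] (z ω')) (f^[i * B + j] y)
  rw [dist_comm (f^[j] (ω i : X)) (f^[i * B + j] (z ω))] at h5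
  linarith

lemma abs_birkhoffSum_gluedSet_sub_le {φ : X → ℝ} {c ε v : ℝ} {Ng : ℕ} (hφ : ∀ y, |φ y| ≤ c)
    (hφτ : ∀ y y', dist y y' ≤ τ → |φ y - φ y'| ≤ ε)
    (hv : ∀ y ∈ S, |birkhoffSum f φ n y - n * v| ≤ n * ε)
    {z : X} (hz : z ∈ gluedSet f S x p n (n + Ng) τ) (k : ℕ) :
    |birkhoffSum f φ (k * (n + Ng)) z
      - (k * (n * v) + Nat.count p k * (birkhoffSum f φ n x - n * v))|
        ≤ k * (2 * n * ε + c * Ng) := by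
  obtain ⟨ω, hω⟩ := hz
  induction k with
  | zero => simp
  | succ k ih =>
    set y := f^[k * (n + Ng)] z with hy
    have h1 : |birkhoffSum f φ n y - birkhoffSum f φ n (if p k then x else (ω k : X))|
        ≤ n * ε := abs_birkhoffSum_sub_le fun j hj => hφτ _ _ (by
      rw [hy, ← Function.iterate_add_apply, add_comm j]
      exact hω k j hj)
    have h2 := abs_birkhoffSum_le (f := f) hφ Ng (f^[n] y)
    have h3 := hv _ (ω k).2
    have hε : 0 ≤ n * ε := (abs_nonneg _).trans h1
    rw [Nat.succ_mul, birkhoffSum_add, birkhoffSum_add f φ n Ng, ← hy, Nat.count_succ]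
    rw [abs_le] at *
    push_cast
    split_ifs at h1 ⊢ with hpk
    · constructor <;> linarith
    · constructor <;> linarith

end GluedSet

lemma exists_subset_card_abs_sub_le {X : Type*} {S : Finset X} {g : X → ℝ} {c ε : ℝ}
    (hc : 0 ≤ c) (hε : 0 < ε) (hg : ∀ x, |g x| ≤ c) :
    ∃ v : ℝ, ∃ T ⊆ S, (∀ x ∈ T, |g x - v| ≤ ε) ∧
      (S.card : ℝ) ≤ (Finset.Icc ⌊-c / ε⌋ ⌊c / ε⌋).card * T.card := by
  set I := Finset.Icc ⌊-c / ε⌋ ⌊c / ε⌋ with hI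
  have hI0 : I.Nonempty := Finset.nonempty_Icc.2 (Int.floor_le_floor (by gcongr; linarith))
  have hIpos : (0 : ℝ) < I.card := by exact_mod_cast hI0.card_pos
  have hmaps : ∀ x ∈ S, ⌊g x / ε⌋ ∈ I := fun x _ => by
    have h := abs_le.1 (hg x)
    exact Finset.mem_Icc.2 ⟨Int.floor_le_floor (by gcongr; exact h.1),
      Int.floor_le_floor (by gcongr; exact h.2)⟩
  obtain ⟨a, -, ha⟩ := Finset.exists_le_card_fiber_of_nsmul_le_card_of_maps_to
    (b := (S.card : ℝ) / I.card) hmaps hI0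
    (by rw [nsmul_eq_mul, mul_div_cancel₀ _ hIpos.ne'])
  refine ⟨a * ε, {x ∈ S | ⌊g x / ε⌋ = a}, Finset.filter_subset _ _, fun x hx => ?_, ?_⟩
  · have h1 := (Finset.mem_filter.1 hx).2
    have h2 := Int.floor_le (g x / ε)
    have h3 := Int.lt_floor_add_one (g x / ε)
    rw [h1] at h2 h3
    rw [le_div_iff₀ hε] at h2
    rw [div_lt_iff₀ hε] at h3
    rw [abs_le]
    constructor <;> linarith
  · rw [div_le_iff₀ hIpos] at ha
    linarith

section IrregularSet

variable {X : Type*} [MetricSpace X] [CompactSpace X] [MeasurableSpace X] [BorelSpace X]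
  {m : ℕ} {f : X ≃ₜ X} {A : X → (Em m ≃L[ℝ] Em m)}

lemma exists_birkhoffSum_far {μ ν : Measure X} [IsProbabilityMeasure μ] [IsProbabilityMeasure ν]
    {f : X → X} (hf : Continuous f) (hμ : MeasurePreserving f μ μ) (hν : MeasurePreserving f ν ν)
    {φ : X → ℝ} (hφ : Continuous φ) {d : ℝ} (hd : ∫ x, φ x ∂μ + 2 * d ≤ ∫ x, φ x ∂ν) (n : ℕ)
    (v : ℝ) : ∃ x, n * d ≤ |birkhoffSum f φ n x - n * v| := by
  have hcont : Continuous (birkhoffSum f φ n) := by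
    unfold birkhoffSum
    exact continuous_finsetSum _ fun i _ => hφ.comp (hf.iterate i)
  rcases le_total (v + d) (∫ x, φ x ∂ν) with h | h
  · obtain ⟨x, hx⟩ := exists_integral_le (hcont.integrable_of_compactSpace ν)
    refine ⟨x, le_trans ?_ (le_abs_self _)⟩
    rw [integral_birkhoffSum hν hf hφ] at hx
    have : (n : ℝ) * (v + d) ≤ n * ∫ x, φ x ∂ν := by gcongr
    linarith
  · obtain ⟨x, hx⟩ := exists_le_integral (hcont.integrable_of_compactSpace μ)
    refine ⟨x, le_trans ?_ (neg_le_abs _)⟩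
    rw [integral_birkhoffSum hμ hf hφ] at hx
    have : (n : ℝ) * ∫ x, φ x ∂μ ≤ n * (v - d) := by gcongr; linarith
    linarith

/-- If two invariant measures have different maximal Lyapunov exponents, the irregular set contains
compact subsets of Bowen entropy arbitrarily close to the topological entropy. -/
lemma exists_compact_subset_mlIrr_le_bowenEnt [NeZero m] (hmix : TopMixingOn (⇑f) univ)
    (hshadow : ExpShadowing f.toEquiv) (hA : HolderMat A)
    (hlsc : LowerSemicontinuousOn (fun μ : ProbabilityMeasure X => mle (⇑f) A (μ : Measure X))
      {μ : ProbabilityMeasure X | MeasurePreserving (⇑f) (μ : Measure X) (μ : Measure X)})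
    {μ ν : ProbabilityMeasure X} (hμ : MeasurePreserving f (μ : Measure X) (μ : Measure X))
    (hν : MeasurePreserving f (ν : Measure X) (ν : Measure X))
    (hlt : mle f A (μ : Measure X) < mle f A (ν : Measure X)) {t : ℝ}
    (ht : (t : EReal) < topEnt f univ) :
    ∃ K ⊆ MLIrr f A, IsCompact K ∧ (t : EReal) ≤ bowenEnt f K := by
  have hf : Continuous f := f.continuous
  have : Nonempty X := nonempty_of_isProbabilityMeasure (μ : Measure X)
  obtain ⟨c, hc⟩ := hA.exists_normLogBound
  have hc0 := hc.1
  obtain ⟨h, hth, hh⟩ := EReal.lt_iff_exists_real_btwn.1 ht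
  rw [topEnt_univ_eq hf] at hh
  obtain ⟨ε₀, hh⟩ := lt_iSup_iff.1 hh
  obtain ⟨hε₀, hh⟩ := lt_iSup_iff.1 hh
  have hfreq := frequently_lt_of_lt_limsup (by isBoundedDefault) hh
  have hth' : t < h := EReal.coe_lt_coe_iff.1 hth
  have hlin : ∀ D : ℝ, ∀ r > 0, ∀ᶠ n : ℕ in atTop, D ≤ r * n := fun D r hr =>
    (tendsto_natCast_atTop_atTop.const_mul_atTop hr).eventually_ge_atTop D
  obtain ⟨q, hqh, hq⟩ := ((hlin (h + 1) (h - t) (by linarith)).and (eventually_gt_atTop 0)).exists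
  have hq' : (0 : ℝ) < q := by exact_mod_cast hq
  have hrate : 0 < (1 - 1 / q) * h - t := by
    have h1 : 1 / q * h < h - t := by
      rw [one_div, inv_mul_lt_iff₀ hq']
      linarith
    linarith
  have h1q : (0 : ℝ) ≤ 1 - 1 / q := by
    rw [sub_nonneg, div_le_one hq']
    exact_mod_cast hq
  obtain ⟨p, hpdec, hp, hplow, hphigh⟩ := exists_oscillating_set hq
  set g := mle f A (ν : Measure X) - mle f A (μ : Measure X) with hg
  have hg0 : 0 < g := by linarith
  set ε := g / (100 * q) with hε
  have hε0 : 0 < ε := by positivity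
  have hεq : 100 * (q * ε) = g := by rw [hε]; field_simp
  have hεg : 100 * ε ≤ g := by
    rw [← hεq]
    have : (1 : ℝ) ≤ q := by exact_mod_cast hq
    nlinarith
  obtain ⟨N, hN, hmle, hclose⟩ :=
    hc.exists_abs_cocycleLog_sub_birkhoffSum_le hmix hshadow hA hlsc hε0
  set φ : X → ℝ := fun y => cocycleLog f A N y / N with hφdef
  have hφc : Continuous φ := (hc.continuous_cocycleLog hf hA.continuous N).div_const _
  have hφb : ∀ y, |φ y| ≤ c := fun y => hc.abs_cocycleLog_div_le N y
  obtain ⟨τ₀, hτ₀, hunif⟩ := Metric.uniformContinuous_iff.1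
    (CompactSpace.uniformContinuous_of_continuous hφc) ε hε0
  set τ := min (ε₀ / 4) (τ₀ / 2) with hτ
  have hτ0 : 0 < τ := by positivity
  have hτ1 : 4 * τ ≤ ε₀ := by linarith [min_le_left (ε₀ / 4) (τ₀ / 2)]
  have hφτ : ∀ y y', dist y y' ≤ τ → |φ y - φ y'| ≤ ε := fun y y' hy =>
    (hunif (by linarith [min_le_right (ε₀ / 4) (τ₀ / 2)])).le
  obtain ⟨lam, hlam, hsh⟩ := hshadow
  obtain ⟨Ng, hNg, hglue⟩ := exists_glued_orbit hmix hsh hτ0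
  set R := (Finset.Icc ⌊-c / ε⌋ ⌊c / ε⌋).card with hR
  obtain ⟨n, hn, ⟨hn0, hn1⟩, hn2⟩ := (hfreq.and_eventually
    (((eventually_gt_atTop 0).and (hlin (t * Ng + (1 - 1 / q) * Real.log R) _ hrate)).and
      (hlin (4 * q * ((c + ε) * Ng)) (g / 16) (by positivity)))).exists
  have hn0' : (0 : ℝ) < n := by exact_mod_cast hn0
  have hn' : h * n < Real.log (sepCount f univ n ε₀) := by
    have := EReal.coe_lt_coe_iff.1 hn
    rwa [lt_div_iff₀ hn0'] at this
  obtain ⟨S, hS, hScard⟩ := exists_card_eq_sepCount hf univ n hε₀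
  have hSpos := sepCount_pos hf (univ_nonempty (α := X)) n hε₀
  rw [← hScard] at hn' hSpos
  obtain ⟨v, T, hTS, hTv, hTcard⟩ := exists_subset_card_abs_sub_le (S := S)
    (g := fun x => birkhoffSum f φ n x / n) hc0 hε0 fun x => by
      rw [abs_div, abs_of_pos hn0', div_le_iff₀ hn0', mul_comm]
      have := abs_birkhoffSum_le (f := f) hφb n x
      linarith
  have hRT : 0 < (R : ℝ) * T.card :=
    lt_of_lt_of_le (by exact_mod_cast hSpos) hTcard
  have hR0 : (R : ℝ) ≠ 0 := fun h0 => by simp [h0] at hRT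
  have hT0 : (T.card : ℝ) ≠ 0 := fun h0 => by simp [h0] at hRT
  have hT : T.Nonempty := Finset.card_ne_zero.1 (by exact_mod_cast hT0)
  have hTlog : h * n ≤ Real.log R + Real.log T.card := by
    rw [← Real.log_mul hR0 hT0]
    exact hn'.le.trans (Real.log_le_log (by exact_mod_cast hSpos) hTcard)
  have hTv' : ∀ y ∈ T, |birkhoffSum f φ n y - n * v| ≤ n * ε := fun y hy => by
    have h1 := hTv y hy
    have h2 : birkhoffSum f φ n y - n * v = n * (birkhoffSum f φ n y / n - v) := by field_simp
    rw [h2, abs_mul, abs_of_pos hn0']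
    gcongr
  obtain ⟨x, hx⟩ : ∃ x, n * (g / 4) ≤ |birkhoffSum f φ n x - n * v| := by
    refine exists_birkhoffSum_far hf hμ hν hφc ?_ n v
    have h1 := hmle μ hμ
    have h2 := hc.mle_le hf hA.continuous (ν : Measure X) hN
    rw [← integral_div] at h1 h2
    linarith
  have hB : 0 < n + Ng := by omega
  refine ⟨gluedSet f T x p n (n + Ng) τ, fun z hz => ?_, isCompact_gluedSet hf, ?_⟩
  · rintro ⟨l, hl⟩
    refine not_tendsto_div_of_oscillating hq hB hplow hphigh
      (L := fun k => cocycleLog f A k z) (a := n * v) (w := birkhoffSum f φ n x - n * v)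
      (e := 3 * n * ε + (c + ε) * Ng) ?_ ?_ l hl
    · filter_upwards [(tendsto_id.atTop_mul_const' hB).eventually hclose] with k hk
      have h1 := abs_le.1 (hk z)
      have h2 := abs_le.1 (abs_birkhoffSum_gluedSet_sub_le hφb hφτ hTv' hz k)
      simp only [id] at h1
      push_cast at h1
      rw [abs_le]
      constructor <;> linarith
    · refine lt_of_lt_of_le ?_ hx
      have h1 : 4 * q * (3 * n * ε + (c + ε) * Ng)
          = 12 * (q * ε) * n + 4 * q * ((c + ε) * Ng) := by ring
      rw [h1]
      have h2 : 12 * (q * ε) * n = 12 / 100 * g * n := by rw [← hεq]; ring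
      have h3 : 0 < g * n := by positivity
      linarith
  · refine le_bowenEnt_gluedSet hT ⟨subset_univ _, fun y hy y' hy' => ?_⟩ hτ0 hτ1
      (Nat.le_add_right _ _) hB hq hp (fun y => ?_) ?_
    · exact hS.2 y (hTS hy) y' (hTS hy')
    · obtain ⟨z, hz⟩ := hglue n hn0 y
      refine ⟨z, fun i j hj => (hz i j hj).le.trans ?_⟩
      refine mul_le_of_le_one_right hτ0.le (Real.exp_le_one_iff.2 ?_)
      have := Nat.cast_nonneg (α := ℝ) (min j (n - j))
      nlinarith
    · have h1 : (1 - 1 / q) * (h * n) ≤ (1 - 1 / q) * (Real.log R + Real.log T.card) := by gcongr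
      push_cast
      linarith

end IrregularSet

lemma mle_eq_zero_of_dim_zero {X : Type*} [MeasurableSpace X] (f : X → X)
    (A : X → (Em 0 ≃L[ℝ] Em 0)) (μ : Measure X) : mle f A μ = 0 := by
  have h : ∀ x n, ‖cocycle f A x n‖ = 0 := fun x n => by
    rw [Subsingleton.elim (cocycle f A x n) 0, norm_zero]
  simp [mle, h]

/-- **Corollary 3.2.** Let `f` be a topologically mixing homeomorphism of a compact metric
space with the exponential shadowing property and `A : X → GL(m,ℝ)` a Hölder continuous matrix
function. If `μ ↦ χ_max(A,μ)` is lower semi-continuous on the invariant measures (weak*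
topology), then either all ergodic measures have the same maximal Lyapunov exponent w.r.t. `A`,
or `h^B_top(f, MLI(A,f)) = h_top(f, MLI(A,f)) = h^P_top(f, MLI(A,f)) = h_top(f)`. -/
theorem mlIrregular_full_entropies_of_lowerSemicontinuous
    {X : Type*} [MetricSpace X] [CompactSpace X] [MeasurableSpace X] [BorelSpace X] {m : ℕ}
    (f : X ≃ₜ X) (hmix : TopMixingOn (⇑f) univ) (hshadow : ExpShadowing f.toEquiv)
    (A : X → (Em m ≃L[ℝ] Em m)) (hA : HolderMat A)
    (hlsc : LowerSemicontinuousOn (fun μ : ProbabilityMeasure X => mle (⇑f) A (μ : Measure X))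
      {μ : ProbabilityMeasure X | MeasurePreserving (⇑f) (μ : Measure X) (μ : Measure X)}) :
    (∀ μ ν : Measure X, IsProbabilityMeasure μ → IsProbabilityMeasure ν →
        Ergodic (⇑f) μ → Ergodic (⇑f) ν → mle (⇑f) A μ = mle (⇑f) A ν) ∨
    (bowenEnt (⇑f) (MLIrr (⇑f) A) = topEnt (⇑f) univ ∧
      topEnt (⇑f) (MLIrr (⇑f) A) = topEnt (⇑f) univ ∧
      packEnt (⇑f) (MLIrr (⇑f) A) = topEnt (⇑f) univ) := by
  refine or_iff_not_imp_left.2 fun hne => ?_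
  push Not at hne
  obtain ⟨μ, ν, hμ, hν, hμe, hνe, hne⟩ := hne
  rcases m.eq_zero_or_pos with rfl | hm
  · exact absurd ((mle_eq_zero_of_dim_zero f A μ).trans (mle_eq_zero_of_dim_zero f A ν).symm) hne
  have : NeZero m := ⟨hm.ne'⟩
  refine entropies_eq_topEnt_univ f.continuous fun t ht => ?_
  rcases lt_or_gt_of_ne hne with hlt | hlt
  · exact exists_compact_subset_mlIrr_le_bowenEnt (μ := ⟨μ, hμ⟩) (ν := ⟨ν, hν⟩) hmix hshadow hA hlsc
      hμe.toMeasurePreserving hνe.toMeasurePreserving hlt ht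
  · exact exists_compact_subset_mlIrr_le_bowenEnt (μ := ⟨ν, hν⟩) (ν := ⟨μ, hμ⟩) hmix hshadow hA hlsc
      hνe.toMeasurePreserving hμe.toMeasurePreserving hlt ht
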